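/- arXiv:1306.3609 — 3 statements merged into one kernel-verified Lean document; each statement's English description precedes it below -/
import Mathlib

section
/- Let k, s ≥ 1 be integers and let Z be a k×s random matrix with i.i.d. N(0,1) entries (its law is the product over entries of the standard Gaussian measure). Then E[ ‖Z‖_op² ] ≤ (6 + 2√(2π)) · max(k, s), where ‖·‖_op denotes the ℓ²→ℓ² operator norm (the largest singular value). -/
open MeasureTheory ProbabilityTheory Matrix
open scoped ENNReal

instance matrixMeasurableSpace {k s : ℕ} : MeasurableSpace (Matrix (Fin k) (Fin s) ℝ) :=
  MeasurableSpace.pi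

/-- The law of a `k × s` random matrix with i.i.d. standard Gaussian entries. -/
noncomputable def stdGaussianMatrix (k s : ℕ) : Measure (Matrix (Fin k) (Fin s) ℝ) :=
  Measure.pi fun _ : Fin k => Measure.pi fun _ : Fin s => gaussianReal 0 1

/-- The `ℓ² → ℓ²` operator norm of a `k × s` real matrix: the supremum of the
Euclidean norm of `A x` over Euclidean-unit vectors `x` (the largest singular value). -/
noncomputable def matrixOpNorm {k s : ℕ} (A : Matrix (Fin k) (Fin s) ℝ) : ℝ :=
  sSup {r : ℝ | ∃ x : Fin s → ℝ, (∑ j, (x j) ^ 2) ≤ 1 ∧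
    r = Real.sqrt (∑ i, (A.mulVec x i) ^ 2)}

/-- A normalised linear form of a standard Gaussian vector is a standard Gaussian variable. -/
lemma measurePreserving_dotProduct_div_norm {s : ℕ} {x : EuclideanSpace ℝ (Fin s)} (hx : x ≠ 0) :
    MeasurePreserving (fun w : Fin s → ℝ ↦ w ⬝ᵥ x.ofLp / ‖x‖)
      (Measure.pi fun _ : Fin s ↦ gaussianReal 0 1) (gaussianReal 0 1) where
  measurable := by
    unfold dotProduct
    fun_prop
  map_eq := by
    set L : StrongDual ℝ (EuclideanSpace ℝ (Fin s)) := innerSL ℝ (‖x‖⁻¹ • x) with hL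
    have hcomp : (fun w : Fin s → ℝ ↦ w ⬝ᵥ x.ofLp / ‖x‖) = L ∘ WithLp.toLp 2 := by
      ext w
      simp only [hL, Function.comp_apply, innerSL_apply_apply,
        EuclideanSpace.inner_eq_star_dotProduct]
      simp [div_eq_inv_mul]
    have hnorm : ‖L‖ = 1 := by
      rw [hL, innerSL_apply_norm, norm_smul, norm_inv, norm_norm,
        inv_mul_cancel₀ (norm_ne_zero_iff.2 hx)]
    rw [hcomp, ← Measure.map_map (by fun_prop) (by fun_prop), map_pi_eq_stdGaussian,
      IsGaussian.map_eq_gaussianReal, integral_strongDual_stdGaussian, variance_dual_stdGaussian,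
      hnorm]
    simp

/-- The moment generating function of the square of a standard Gaussian variable at `3 / 8`. -/
lemma lintegral_exp_sq_gaussianReal :
    ∫⁻ y, ENNReal.ofReal (Real.exp (3 / 8 * y ^ 2)) ∂(gaussianReal 0 1) = 2 := by
  have hdens (y : ℝ) : gaussianPDF 0 1 y * ENNReal.ofReal (Real.exp (3 / 8 * y ^ 2)) =
      ENNReal.ofReal ((√(2 * Real.pi))⁻¹ * Real.exp (-(1 / 8) * y ^ 2)) := by
    rw [gaussianPDF, ← ENNReal.ofReal_mul (gaussianPDFReal_nonneg _ _ _), gaussianPDFReal,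
      mul_assoc, ← Real.exp_add]
    simp only [NNReal.coe_one, mul_one, sub_zero]
    ring_nf
  rw [gaussianReal_of_var_ne_zero _ one_ne_zero,
    lintegral_withDensity_eq_lintegral_mul _ (by fun_prop) (by fun_prop)]
  simp only [Pi.mul_apply, hdens]
  rw [← ofReal_integral_eq_lintegral_ofReal
    ((integrable_exp_neg_mul_sq (by norm_num : (0 : ℝ) < 1 / 8)).const_mul _)
    (.of_forall fun y ↦ by positivity), integral_const_mul, integral_gaussian]
  have : √(Real.pi / (1 / 8)) = 2 * √(2 * Real.pi) := by
    rw [show Real.pi / (1 / 8) = 2 ^ 2 * (2 * Real.pi) by ring, Real.sqrt_mul (by norm_num),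
      Real.sqrt_sq (by norm_num)]
  have hpos : √(2 * Real.pi) ≠ 0 := by positivity
  rw [this, show (√(2 * Real.pi))⁻¹ * (2 * √(2 * Real.pi)) = 2 by field_simp]
  simp

instance isProbabilityMeasure_stdGaussianMatrix (k s : ℕ) :
    IsProbabilityMeasure (stdGaussianMatrix k s) := by
  unfold stdGaussianMatrix
  exact Measure.pi.instIsProbabilityMeasure _

/-- `‖z x‖² / ‖x‖²`, the Rayleigh quotient of `zᵀ z` at `x`. -/
noncomputable def rayleighSq {k s : ℕ} (z : Matrix (Fin k) (Fin s) ℝ)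
    (x : EuclideanSpace ℝ (Fin s)) : ℝ :=
  ∑ i, (z i ⬝ᵥ x.ofLp / ‖x‖) ^ 2

lemma measurable_rayleighSq {k s : ℕ} :
    Measurable fun p : Matrix (Fin k) (Fin s) ℝ × EuclideanSpace ℝ (Fin s) ↦
      rayleighSq p.1 p.2 := by
  have hentry (i : Fin k) (j : Fin s) :
      Measurable fun p : Matrix (Fin k) (Fin s) ℝ × EuclideanSpace ℝ (Fin s) ↦ p.1 i j :=
    (measurable_pi_apply j).comp ((measurable_pi_apply i).comp measurable_fst)
  unfold rayleighSq dotProduct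
  fun_prop

lemma lintegral_exp_rayleighSq_le {k s : ℕ} (x : EuclideanSpace ℝ (Fin s)) :
    ∫⁻ z, ENNReal.ofReal (Real.exp (3 / 8 * rayleighSq z x)) ∂(stdGaussianMatrix k s) ≤ 2 ^ k := by
  rcases eq_or_ne x 0 with rfl | hx
  · simpa [rayleighSq] using one_le_pow₀ (one_le_two (α := ℝ≥0∞))
  have hrow := measurePreserving_dotProduct_div_norm hx
  set g : (Fin s → ℝ) → ℝ≥0∞ :=
    fun w ↦ ENNReal.ofReal (Real.exp (3 / 8 * (w ⬝ᵥ x.ofLp / ‖x‖) ^ 2)) with hg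
  have hgm : Measurable g := by
    have := hrow.measurable
    fun_prop
  have hprod (z : Matrix (Fin k) (Fin s) ℝ) :
      ENNReal.ofReal (Real.exp (3 / 8 * rayleighSq z x)) = ∏ i, g (z i) := by
    rw [rayleighSq, Finset.mul_sum, Real.exp_sum,
      ENNReal.ofReal_prod_of_nonneg fun _ _ ↦ (Real.exp_pos _).le]
  simp only [hprod]
  have hone : ∫⁻ w, g w ∂(Measure.pi fun _ : Fin s ↦ gaussianReal 0 1) = 2 := by
    rw [← lintegral_exp_sq_gaussianReal, ← hrow.lintegral_comp (by fun_prop)]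
  have hindep := lintegral_prod_eq_prod_lintegral_of_indepFun Finset.univ
    (fun (i : Fin k) (z : Fin k → Fin s → ℝ) ↦ g (z i))
    (iIndepFun_pi (μ := fun _ : Fin k ↦ Measure.pi fun _ : Fin s ↦ gaussianReal 0 1)
      fun _ ↦ hgm.aemeasurable)
    (fun i ↦ hgm.comp (measurable_pi_apply i))
  refine (hindep.trans ?_).le
  have hcoord (i : Fin k) : ∫⁻ z : Fin k → Fin s → ℝ, g (z i)
      ∂(Measure.pi fun _ : Fin k ↦ Measure.pi fun _ : Fin s ↦ gaussianReal 0 1) = 2 := by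
    rw [← hone]
    exact (measurePreserving_eval
      (fun _ : Fin k ↦ Measure.pi fun _ : Fin s ↦ gaussianReal 0 1) i).lintegral_comp hgm
  simp [hcoord]

/-- The supremum defining `matrixOpNorm` is attained. -/
lemma exists_matrixOpNorm_eq {k s : ℕ} (z : Matrix (Fin k) (Fin s) ℝ) :
    ∃ x : Fin s → ℝ, ∑ j, x j ^ 2 ≤ 1 ∧ matrixOpNorm z = √(∑ i, (z.mulVec x i) ^ 2) := by
  have hcompact : IsCompact {x : Fin s → ℝ | ∑ j, x j ^ 2 ≤ 1} := by
    refine Metric.isCompact_of_isClosed_isBounded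
      (isClosed_le (by fun_prop) continuous_const) ?_
    refine (Metric.isBounded_closedBall (x := (0 : Fin s → ℝ)) (r := 1)).subset fun x hx ↦ ?_
    rw [mem_closedBall_zero_iff, pi_norm_le_iff_of_nonneg zero_le_one]
    intro j
    rw [Real.norm_eq_abs, ← sq_le_one_iff_abs_le_one]
    exact (Finset.single_le_sum (f := fun j ↦ x j ^ 2) (fun _ _ ↦ sq_nonneg _)
      (Finset.mem_univ j)).trans hx
  have hcont : Continuous fun x : Fin s → ℝ ↦ √(∑ i, (z.mulVec x i) ^ 2) := by
    have : Continuous fun x : Fin s → ℝ ↦ z.mulVec x := by fun_prop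
    fun_prop
  have himage : {r : ℝ | ∃ x : Fin s → ℝ, ∑ j, x j ^ 2 ≤ 1 ∧ r = √(∑ i, (z.mulVec x i) ^ 2)} =
      (fun x : Fin s → ℝ ↦ √(∑ i, (z.mulVec x i) ^ 2)) '' {x | ∑ j, x j ^ 2 ≤ 1} := by
    ext r
    simp [eq_comm]
  have hmem := (hcompact.image hcont).sSup_mem (Set.Nonempty.image _ ⟨0, by simp⟩)
  rw [← himage] at hmem
  exact hmem

lemma exists_unit_matrixOpNorm_mul_inner_le {k s : ℕ} (hs : 1 ≤ s)
    (z : Matrix (Fin k) (Fin s) ℝ) :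
    0 ≤ matrixOpNorm z ∧ ∃ v : EuclideanSpace ℝ (Fin s), ‖v‖ = 1 ∧
      ∀ x, matrixOpNorm z * inner ℝ v x ≤ √(∑ i, (z i ⬝ᵥ x.ofLp) ^ 2) := by
  obtain ⟨y, hy, hM⟩ := exists_matrixOpNorm_eq z
  set M := matrixOpNorm z
  have hM0 : 0 ≤ M := hM ▸ Real.sqrt_nonneg _
  refine ⟨hM0, ?_⟩
  rcases hM0.eq_or_lt with hzero | hpos
  · refine ⟨EuclideanSpace.single ⟨0, hs⟩ 1, by simp, fun x ↦ ?_⟩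
    rw [← hzero, zero_mul]
    exact Real.sqrt_nonneg _
  have hsq : ∑ i, (z i ⬝ᵥ y) ^ 2 = M ^ 2 := by
    rw [hM, Real.sq_sqrt (Finset.sum_nonneg fun _ _ ↦ sq_nonneg _)]
    rfl
  set Y : EuclideanSpace ℝ (Fin s) := WithLp.toLp 2 y
  have hY : ‖Y‖ ≤ 1 := by
    rw [← sq_le_one_iff₀ (norm_nonneg _), EuclideanSpace.real_norm_sq_eq]
    exact hy
  set a : EuclideanSpace ℝ (Fin s) := WithLp.toLp 2 (vecMul (fun i ↦ z i ⬝ᵥ y) z)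
  have hinner (x : EuclideanSpace ℝ (Fin s)) :
      inner ℝ a x = ∑ i, (z i ⬝ᵥ y) * (z i ⬝ᵥ x.ofLp) := by
    rw [EuclideanSpace.inner_eq_star_dotProduct, dotProduct_comm]
    simp only [star_trivial, a]
    rw [← dotProduct_mulVec]
    rfl
  have hle (x : EuclideanSpace ℝ (Fin s)) :
      inner ℝ a x ≤ M * √(∑ i, (z i ⬝ᵥ x.ofLp) ^ 2) := by
    rw [hinner]
    refine (Real.sum_mul_le_sqrt_mul_sqrt _ _ _).trans ?_
    rw [hsq, Real.sqrt_sq hM0]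
  have hna : M ^ 2 ≤ ‖a‖ := by
    calc M ^ 2 = inner ℝ a Y := by
          rw [hinner, ← hsq]
          exact Finset.sum_congr rfl fun _ _ ↦ sq _
      _ ≤ ‖a‖ * ‖Y‖ := real_inner_le_norm _ _
      _ ≤ ‖a‖ := mul_le_of_le_one_right (norm_nonneg _) hY
  have hapos : 0 < ‖a‖ := (pow_pos hpos 2).trans_le hna
  refine ⟨‖a‖⁻¹ • a, by simp [norm_smul, hapos.ne'], fun x ↦ ?_⟩
  rw [real_inner_smul_left]
  set S := √(∑ i, (z i ⬝ᵥ x.ofLp) ^ 2) with hS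
  have hS0 : 0 ≤ S := Real.sqrt_nonneg _
  rw [← mul_assoc, ← div_eq_mul_inv, div_mul_eq_mul_div, div_le_iff₀ hapos]
  calc M * inner ℝ a x ≤ M * (M * S) := mul_le_mul_of_nonneg_left (hle x) hM0
    _ = S * M ^ 2 := by ring
    _ ≤ S * ‖a‖ := mul_le_mul_of_nonneg_left hna hS0

/-- The ball of radius `1 / 3` around `(2 / 3) v` lies in the unit ball and in the cone of
half-angle `π / 6` around the unit vector `v`. -/
lemma norm_mul_le_inner_of_mem_closedBall {E : Type*} [NormedAddCommGroup E]
    [InnerProductSpace ℝ E] {v x : E} (hv : ‖v‖ = 1)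
    (hx : x ∈ Metric.closedBall ((2 / 3 : ℝ) • v) (1 / 3)) :
    0 < ‖x‖ ∧ ‖x‖ ≤ 1 ∧ 0 ≤ inner ℝ v x ∧ 3 / 4 * ‖x‖ ^ 2 ≤ inner ℝ v x ^ 2 := by
  rw [mem_closedBall_iff_norm] at hx
  have hexpand : ‖x - (2 / 3 : ℝ) • v‖ ^ 2 = ‖x‖ ^ 2 - 4 / 3 * inner ℝ v x + 4 / 9 := by
    rw [norm_sub_sq_real, real_inner_smul_right, real_inner_comm, norm_smul, hv]
    norm_num
    ring
  have hsq : ‖x - (2 / 3 : ℝ) • v‖ ^ 2 ≤ (1 / 3) ^ 2 := pow_le_pow_left₀ (norm_nonneg _) hx 2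
  have hlin : 3 / 4 * ‖x‖ ^ 2 + 1 / 4 ≤ inner ℝ v x := by linarith
  have hcs : inner ℝ v x ≤ ‖x‖ := by simpa [hv] using real_inner_le_norm v x
  have hx0 := norm_nonneg x
  refine ⟨by nlinarith, by nlinarith, by nlinarith, ?_⟩
  nlinarith [sq_nonneg (3 / 4 * ‖x‖ ^ 2 - 1 / 4), pow_le_pow_left₀ (by positivity) hlin 2]

lemma exp_matrixOpNorm_sq_mul_le {k s : ℕ} (hs : 1 ≤ s) (z : Matrix (Fin k) (Fin s) ℝ) :
    ENNReal.ofReal (Real.exp (9 / 32 * matrixOpNorm z ^ 2)) *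
        (ENNReal.ofReal ((1 / 3) ^ s) *
          volume (Metric.closedBall (0 : EuclideanSpace ℝ (Fin s)) 1)) ≤
      ∫⁻ x in Metric.closedBall (0 : EuclideanSpace ℝ (Fin s)) 1,
        ENNReal.ofReal (Real.exp (3 / 8 * rayleighSq z x)) := by
  obtain ⟨hM0, v, hv, hle⟩ := exists_unit_matrixOpNorm_mul_inner_le hs z
  set B := Metric.closedBall ((2 / 3 : ℝ) • v) (1 / 3) with hB
  have hvol : volume B = ENNReal.ofReal ((1 / 3) ^ s) *
      volume (Metric.closedBall (0 : EuclideanSpace ℝ (Fin s)) 1) := by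
    rw [hB, Measure.addHaar_closedBall' _ _ (by norm_num), finrank_euclideanSpace_fin]
  rw [← hvol, ← setLIntegral_const]
  have hsub : B ⊆ Metric.closedBall 0 1 := fun x hx ↦
    mem_closedBall_zero_iff.2 (norm_mul_le_inner_of_mem_closedBall hv hx).2.1
  refine le_trans (setLIntegral_mono' Metric.isClosed_closedBall.measurableSet fun x hx ↦ ?_)
    (lintegral_mono_set hsub)
  obtain ⟨hx0, -, hvx, hcone⟩ := norm_mul_le_inner_of_mem_closedBall hv hx
  refine ENNReal.ofReal_le_ofReal (Real.exp_le_exp.2 ?_)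
  have hsq : (matrixOpNorm z * inner ℝ v x) ^ 2 ≤ ∑ i, (z i ⬝ᵥ x.ofLp) ^ 2 := by
    rw [← Real.sq_sqrt (Finset.sum_nonneg fun i _ ↦ sq_nonneg (z i ⬝ᵥ x.ofLp))]
    exact pow_le_pow_left₀ (mul_nonneg hM0 hvx) (hle x) 2
  have hray : 3 / 4 * matrixOpNorm z ^ 2 ≤ rayleighSq z x := by
    simp only [rayleighSq, div_pow]
    rw [← Finset.sum_div, le_div_iff₀ (by positivity)]
    nlinarith [mul_le_mul_of_nonneg_left hcone (sq_nonneg (matrixOpNorm z))]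
  linarith

lemma lintegral_exp_matrixOpNorm_sq_le (k s : ℕ) (hs : 1 ≤ s) :
    ∫⁻ z, ENNReal.ofReal (Real.exp (9 / 32 * matrixOpNorm z ^ 2)) ∂(stdGaussianMatrix k s) ≤
      2 ^ k * 3 ^ s := by
  set V := volume (Metric.closedBall (0 : EuclideanSpace ℝ (Fin s)) 1)
  have hV0 : V ≠ 0 := (Metric.measure_closedBall_pos _ _ one_pos).ne'
  have hVtop : V ≠ ∞ := measure_closedBall_lt_top.ne
  set c := ENNReal.ofReal ((1 / 3) ^ s) with hc
  have hc_eq : c = (3 ^ s)⁻¹ := by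
    rw [hc, ENNReal.ofReal_pow (by norm_num), one_div, ENNReal.ofReal_inv_of_pos (by norm_num),
      ENNReal.inv_pow]
    simp
  have hcV : c * V ≠ ∞ := ENNReal.mul_ne_top ENNReal.ofReal_ne_top hVtop
  have key : (∫⁻ z, ENNReal.ofReal (Real.exp (9 / 32 * matrixOpNorm z ^ 2))
      ∂(stdGaussianMatrix k s)) * (c * V) ≤ 2 ^ k * V := by
    rw [← lintegral_mul_const' _ _ hcV]
    refine (lintegral_mono fun z ↦ exp_matrixOpNorm_sq_mul_le hs z).trans ?_
    rw [lintegral_lintegral_swap (by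
      have := measurable_rayleighSq (k := k) (s := s)
      exact Measurable.aemeasurable (by unfold Function.uncurry; fun_prop))]
    refine (lintegral_mono fun x ↦ lintegral_exp_rayleighSq_le x).trans ?_
    rw [setLIntegral_const]
  rw [← mul_assoc] at key
  have := (ENNReal.mul_le_mul_iff_left hV0 hVtop).1 key
  rw [hc_eq, ← div_eq_mul_inv] at this
  exact (ENNReal.div_le_iff (by positivity) (by finiteness)).1 this

/-- for a `k × s` random matrix `Z` with i.i.d. `N(0,1)` entries,
`E[‖Z‖_op²] ≤ (6 + 2√(2π)) · max(k, s)`. -/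
theorem gaussian_matrix_opnorm_second_moment (k s : ℕ) (hk : 1 ≤ k) (hs : 1 ≤ s) :
    (∫⁻ z, ENNReal.ofReal (matrixOpNorm z ^ 2) ∂(stdGaussianMatrix k s))
      ≤ ENNReal.ofReal ((6 + 2 * Real.sqrt (2 * Real.pi)) * (max k s : ℝ)) := by
  set n : ℝ := max (k : ℝ) s
  have hn : 1 ≤ n := le_max_of_le_left (by exact_mod_cast hk)
  have hexp : (2 : ℝ≥0∞) ^ k * 3 ^ s ≤ ENNReal.ofReal (Real.exp (3 * n)) := by
    have h2 : (2 : ℝ) ^ k ≤ Real.exp n := by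
      calc (2 : ℝ) ^ k ≤ Real.exp 1 ^ k :=
            pow_le_pow_left₀ (by norm_num) (by linarith [Real.add_one_le_exp 1]) k
        _ = Real.exp k := by rw [← Real.exp_nat_mul, mul_one]
        _ ≤ Real.exp n := Real.exp_le_exp.2 (le_max_left _ _)
    have h3 : (3 : ℝ) ^ s ≤ Real.exp (2 * n) := by
      calc (3 : ℝ) ^ s ≤ Real.exp 2 ^ s :=
            pow_le_pow_left₀ (by norm_num) (by linarith [Real.add_one_le_exp 2]) s
        _ = Real.exp (2 * s) := by rw [← Real.exp_nat_mul, mul_comm]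
        _ ≤ Real.exp (2 * n) :=
            Real.exp_le_exp.2 (mul_le_mul_of_nonneg_left (le_max_right _ _) zero_le_two)
    calc (2 : ℝ≥0∞) ^ k * 3 ^ s = ENNReal.ofReal (2 ^ k * 3 ^ s) := by
          rw [ENNReal.ofReal_mul (by positivity), ENNReal.ofReal_pow (by norm_num),
            ENNReal.ofReal_pow (by norm_num)]
          simp
      _ ≤ ENNReal.ofReal (Real.exp (3 * n)) := by
          refine ENNReal.ofReal_le_ofReal ?_
          rw [show 3 * n = n + 2 * n by ring, Real.exp_add]
          exact mul_le_mul h2 h3 (by positivity) (by positivity)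
  have hpoint (z : Matrix (Fin k) (Fin s) ℝ) : ENNReal.ofReal (matrixOpNorm z ^ 2) ≤
      ENNReal.ofReal (32 / 9 * Real.exp (-(3 * n))) *
          ENNReal.ofReal (Real.exp (9 / 32 * matrixOpNorm z ^ 2)) +
        ENNReal.ofReal (32 / 9 * (3 * n - 1)) := by
    rw [← ENNReal.ofReal_mul (by positivity), ← ENNReal.ofReal_add (by positivity) (by linarith),
      mul_assoc, ← Real.exp_add]
    refine ENNReal.ofReal_le_ofReal ?_
    linarith [Real.add_one_le_exp (-(3 * n) + 9 / 32 * matrixOpNorm z ^ 2)]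
  have hpi : 2.4 ≤ √(2 * Real.pi) :=
    Real.le_sqrt_of_sq_le (by linarith [Real.pi_gt_three])
  calc ∫⁻ z, ENNReal.ofReal (matrixOpNorm z ^ 2) ∂(stdGaussianMatrix k s)
      ≤ ENNReal.ofReal (32 / 9 * Real.exp (-(3 * n))) *
            ∫⁻ z, ENNReal.ofReal (Real.exp (9 / 32 * matrixOpNorm z ^ 2))
              ∂(stdGaussianMatrix k s) +
          ENNReal.ofReal (32 / 9 * (3 * n - 1)) := by
        refine (lintegral_mono hpoint).trans_eq ?_
        rw [lintegral_add_right _ measurable_const, lintegral_const_mul' _ _ ENNReal.ofReal_ne_top,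
          lintegral_const, measure_univ, mul_one]
    _ ≤ ENNReal.ofReal (32 / 9 * Real.exp (-(3 * n))) * ENNReal.ofReal (Real.exp (3 * n)) +
          ENNReal.ofReal (32 / 9 * (3 * n - 1)) := by
        gcongr
        exact (lintegral_exp_matrixOpNorm_sq_le k s hs).trans hexp
    _ = ENNReal.ofReal (32 / 3 * n) := by
        rw [← ENNReal.ofReal_mul (by positivity), mul_assoc, ← Real.exp_add, neg_add_cancel,
          Real.exp_zero, ← ENNReal.ofReal_add (by norm_num) (by linarith)]
        ring_nf
    _ ≤ ENNReal.ofReal ((6 + 2 * √(2 * Real.pi)) * n) :=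
        ENNReal.ofReal_le_ofReal (mul_le_mul_of_nonneg_right (by linarith) (by linarith))
end

section
/- (Norm dispersion lemma) There exists an absolute constant c₀ ∈ (0, 1) such that the following holds. Let k ≥ 50 and s ≥ 1 be integers. For any matrix D ∈ ℝ^{k×s}, there exists a matrix W ∈ ℝ^{k×s} with ‖W‖_F ≤ ‖D‖_F such that for every subset B ⊆ {1,…,k} with |B| = ⌊(1 − c₀)·k⌋ and every unitarily invariant norm ‖·‖ on ℝ^{k×s}, one has ‖W^{(B)}‖ ≥ c₀ · ‖D‖, where W^{(B)} ∈ ℝ^{k×s} is the matrix obtained from W by replacing every row whose index lies outside B with the zero row. -/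
open Matrix

/-- `nrm` is a norm on the space of `k × s` real matrices. -/
def IsMatrixNorm {k s : ℕ} (nrm : Matrix (Fin k) (Fin s) ℝ → ℝ) : Prop :=
  (∀ A B, nrm (A + B) ≤ nrm A + nrm B) ∧
  (∀ (c : ℝ) A, nrm (c • A) = |c| * nrm A) ∧
  (∀ A, nrm A = 0 → A = 0)

/-- `nrm` is invariant under left and right multiplication by orthogonal matrices. -/
def IsUnitarilyInvariant {k s : ℕ} (nrm : Matrix (Fin k) (Fin s) ℝ → ℝ) : Prop :=
  ∀ (U : Matrix (Fin k) (Fin k) ℝ) (V : Matrix (Fin s) (Fin s) ℝ)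
    (A : Matrix (Fin k) (Fin s) ℝ), U * Uᵀ = 1 → V * Vᵀ = 1 → nrm (U * A * V) = nrm A

/-- The Frobenius norm of a real matrix. -/
noncomputable def frobNorm {k s : ℕ} (A : Matrix (Fin k) (Fin s) ℝ) : ℝ :=
  Real.sqrt (∑ i, ∑ j, (A i j) ^ 2)

/-- The matrix obtained from `W` by replacing every row whose index lies outside `B`
with the zero row. -/
def rowRestrict {k s : ℕ} (B : Finset (Fin k)) (W : Matrix (Fin k) (Fin s) ℝ) :
    Matrix (Fin k) (Fin s) ℝ :=
  Matrix.of fun i j => if i ∈ B then W i j else 0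

/-- The rectangular `k × s` matrix with diagonal `σ 0, σ 1, …` and zeros elsewhere. -/
def rectDiag (k s : ℕ) (σ : ℕ → ℝ) : Matrix (Fin k) (Fin s) ℝ :=
  Matrix.of fun i j => if (i : ℕ) = j then σ i else 0

section Norm

variable {k s : ℕ} {nrm : Matrix (Fin k) (Fin s) ℝ → ℝ}

theorem IsMatrixNorm.map_zero (hn : IsMatrixNorm nrm) : nrm 0 = 0 := by
  simpa using hn.2.1 0 0

theorem IsMatrixNorm.nonneg (hn : IsMatrixNorm nrm) (A : Matrix (Fin k) (Fin s) ℝ) :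
    0 ≤ nrm A := by
  have h1 := hn.1 A ((-1 : ℝ) • A)
  rw [hn.2.1] at h1
  have h2 : A + (-1 : ℝ) • A = 0 := by simp
  rw [h2, hn.map_zero] at h1
  norm_num at h1
  exact h1

theorem IsMatrixNorm.map_sum_le (hn : IsMatrixNorm nrm) {ι : Type*} (t : Finset ι)
    (f : ι → Matrix (Fin k) (Fin s) ℝ) : nrm (∑ a ∈ t, f a) ≤ ∑ a ∈ t, nrm (f a) := by
  classical
  induction t using Finset.induction_on with
  | empty => simp [hn.map_zero]
  | insert a t ha ih =>
    rw [Finset.sum_insert ha, Finset.sum_insert ha]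
    exact (hn.1 _ _).trans (by gcongr)

theorem IsUnitarilyInvariant.map_mul_left (hu : IsUnitarilyInvariant nrm)
    {U : Matrix (Fin k) (Fin k) ℝ} (hU : U * Uᵀ = 1) (A : Matrix (Fin k) (Fin s) ℝ) :
    nrm (U * A) = nrm A := by
  simpa using hu U 1 A hU (by simp)

theorem IsUnitarilyInvariant.map_mul_right (hu : IsUnitarilyInvariant nrm)
    {V : Matrix (Fin s) (Fin s) ℝ} (hV : V * Vᵀ = 1) (A : Matrix (Fin k) (Fin s) ℝ) :
    nrm (A * V) = nrm A := by
  simpa using hu 1 V A (by simp) hV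

theorem IsUnitarilyInvariant.map_submatrix (hu : IsUnitarilyInvariant nrm)
    (e : Equiv.Perm (Fin k)) (f : Equiv.Perm (Fin s)) (A : Matrix (Fin k) (Fin s) ℝ) :
    nrm (A.submatrix e f) = nrm A := by
  have h1 : A.submatrix e f = (e.toPEquiv.toMatrix : Matrix (Fin k) (Fin k) ℝ) * A *
      (f.symm.toPEquiv.toMatrix : Matrix (Fin s) (Fin s) ℝ) := by
    rw [PEquiv.toMatrix_toPEquiv_mul, PEquiv.mul_toMatrix_toPEquiv]
    rfl
  rw [h1]
  apply hu
  · rw [← PEquiv.toMatrix_symm, ← PEquiv.toMatrix_trans, ← Equiv.toPEquiv_symm,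
      ← Equiv.toPEquiv_trans]
    simp
  · rw [← PEquiv.toMatrix_symm, ← PEquiv.toMatrix_trans, ← Equiv.toPEquiv_symm,
      ← Equiv.toPEquiv_trans]
    simp

theorem IsUnitarilyInvariant.scale_row_le (hn : IsMatrixNorm nrm) (hu : IsUnitarilyInvariant nrm)
    (p : Fin k) {θ : ℝ} (h0 : 0 ≤ θ) (h1 : θ ≤ 1) (A : Matrix (Fin k) (Fin s) ℝ) :
    nrm (Matrix.of fun i j => (if i = p then θ else 1) * A i j) ≤ nrm A := by
  let S : Matrix (Fin k) (Fin k) ℝ := Matrix.diagonal fun i => if i = p then -1 else 1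
  have hS : S * Sᵀ = 1 := by
    rw [Matrix.diagonal_transpose, Matrix.diagonal_mul_diagonal, ← Matrix.diagonal_one]
    congr 1
    ext i
    split_ifs <;> simp
  have hA : (Matrix.of fun i j => (if i = p then θ else 1) * A i j)
      = ((1 + θ) / 2) • A + ((1 - θ) / 2) • (S * A) := by
    ext i j
    simp only [Matrix.of_apply, Matrix.add_apply, Matrix.smul_apply, smul_eq_mul, S,
      Matrix.diagonal_mul]
    split_ifs <;> ring
  rw [hA]
  refine (hn.1 _ _).trans ?_
  rw [hn.2.1, hn.2.1, hu.map_mul_left hS, abs_of_nonneg (by linarith),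
    abs_of_nonneg (by linarith)]
  linarith

theorem IsUnitarilyInvariant.scale_rows_le (hn : IsMatrixNorm nrm)
    (hu : IsUnitarilyInvariant nrm) {θ : Fin k → ℝ} (h0 : ∀ i, 0 ≤ θ i) (h1 : ∀ i, θ i ≤ 1)
    (A : Matrix (Fin k) (Fin s) ℝ) : nrm (Matrix.of fun i j => θ i * A i j) ≤ nrm A := by
  suffices H : ∀ t : Finset (Fin k),
      nrm (Matrix.of fun i j => (if i ∈ t then θ i else 1) * A i j) ≤ nrm A by
    simpa using H Finset.univ
  intro t
  induction t using Finset.induction_on with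
  | empty =>
    have : (Matrix.of fun i j => A i j) = A := rfl
    simp [this]
  | insert p t hp ih =>
    refine le_trans (le_of_eq ?_) ((scale_row_le hn hu p (h0 p) (h1 p) _).trans ih)
    congr 1
    ext i j
    by_cases hi : i = p
    · subst hi
      simp [hp]
    · simp [hi]

theorem IsUnitarilyInvariant.rectDiag_le (hn : IsMatrixNorm nrm) (hu : IsUnitarilyInvariant nrm)
    {σ τ : ℕ → ℝ} (h0 : ∀ p, 0 ≤ σ p) (h1 : ∀ p, σ p ≤ τ p) :
    nrm (rectDiag k s σ) ≤ nrm (rectDiag k s τ) := by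
  refine le_trans (le_of_eq ?_) (scale_rows_le hn hu (θ := fun i => σ i / τ i)
    (fun i => div_nonneg (h0 _) ((h0 _).trans (h1 _)))
    (fun i => div_le_one_of_le₀ (h1 _) ((h0 _).trans (h1 _))) _)
  congr 1
  ext i j
  simp only [rectDiag, Matrix.of_apply]
  split_ifs
  · rcases eq_or_ne (τ i) 0 with h | h
    · have := h0 i
      have := h1 i
      simp [h]
      linarith
    · field_simp
  · simp

end Norm

/-- A permutation of `Fin k` extending the affine map `i ↦ b * i + a`. -/
theorem exists_perm_affine (k b a : ℕ) (hb : 0 < b) :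
    ∃ e : Equiv.Perm (Fin k), ∀ i : Fin k, b * i + a < k → (e i : ℕ) = b * i + a := by
  let f : Fin k → Fin k := fun i => if h : b * i + a < k then ⟨b * i + a, h⟩ else i
  have hinj : Set.InjOn f (Finset.univ.filter fun i : Fin k => b * i + a < k) := by
    intro x hx y hy hxy
    simp only [Finset.coe_filter, Finset.mem_univ, true_and, Set.mem_ofPred_eq] at hx hy
    simp only [f, hx, hy, dif_pos, Fin.mk.injEq] at hxy
    exact Fin.ext (Nat.eq_of_mul_eq_mul_left hb (by omega))
  obtain ⟨g, hg⟩ := Finset.exists_equiv_extend_of_card_eq (t := Finset.univ) (by simp)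
    (Finset.subset_univ _) hinj
  refine ⟨g.trans (Equiv.subtypeUnivEquiv (by simp)), fun i hi => ?_⟩
  have := hg i (by simpa using hi)
  simp only [f, hi, dif_pos] at this
  simp [Equiv.subtypeUnivEquiv, this]

/-- If `τ` dominates the decreasing sequence `σ` sampled along multiples of `b`, up to a factor
`C`, then the norm of the diagonal matrix of `τ` controls that of `σ` up to a factor `b * C`. -/
theorem IsUnitarilyInvariant.rectDiag_le_of_dilation {k s : ℕ}
    {nrm : Matrix (Fin k) (Fin s) ℝ → ℝ} (hn : IsMatrixNorm nrm) (hu : IsUnitarilyInvariant nrm)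
    {σ τ : ℕ → ℝ} (hσ : Antitone σ) (h0 : ∀ p, 0 ≤ σ p) (hτ : ∀ p, 0 ≤ τ p) {b : ℕ}
    (hb : 0 < b) {C : ℝ} (hC : 0 ≤ C)
    (h : ∀ p, b * p < k → b * p < s → σ (b * p) ≤ C * τ p) :
    nrm (rectDiag k s σ) ≤ b * (C * nrm (rectDiag k s τ)) := by
  let P : ℕ → Matrix (Fin k) (Fin s) ℝ := fun a =>
    Matrix.of fun i j => if (i : ℕ) = j ∧ (i : ℕ) % b = a then σ i else 0
  have hsum : rectDiag k s σ = ∑ a ∈ Finset.range b, P a := by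
    ext i j
    simp only [rectDiag, P, Matrix.sum_apply, Matrix.of_apply]
    by_cases hij : (i : ℕ) = j
    · rw [Finset.sum_eq_single ((i : ℕ) % b)]
      · simp [hij]
      · intro a _ ha
        simp [ha.symm]
      · intro hx
        exact absurd (Finset.mem_range.2 (Nat.mod_lt _ hb)) hx
    · simp [hij]
  have hP : ∀ a ∈ Finset.range b, nrm (P a) ≤ C * nrm (rectDiag k s τ) := by
    intro a ha
    have hab := Finset.mem_range.1 ha
    obtain ⟨e, he⟩ := exists_perm_affine k b a hb
    obtain ⟨f, hf⟩ := exists_perm_affine s b a hb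
    have hsub : (P a).submatrix e f = rectDiag k s
        (fun p => if b * p + a < k ∧ b * p + a < s then σ (b * p + a) else 0) := by
      ext i j
      simp only [P, rectDiag, Matrix.submatrix_apply, Matrix.of_apply]
      by_cases hi : b * i + a < k ∧ b * i + a < s
      · have hbi : (i : ℕ) ≤ b * i := Nat.le_mul_of_pos_left _ hb
        have hei := he i hi.1
        have hfi := hf ⟨i, by omega⟩ hi.2
        have hmod : (b * (i : ℕ) + a) % b = a := by
          rw [Nat.mul_add_mod, Nat.mod_eq_of_lt hab]
        have hiff : (b * (i : ℕ) + a = f j) ↔ (i : ℕ) = j := by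
          simp only at hfi
          rw [← hfi, ← Fin.ext_iff, f.injective.eq_iff, Fin.ext_iff]
        simp only [hei, hmod, hi, hiff, and_self, and_true, if_true]
      · simp only [hi, if_false, ite_self]
        rw [if_neg]
        rintro ⟨h1, h2⟩
        apply hi
        have hq : b * ((e i : ℕ) / b) + a = e i := by
          have := Nat.div_add_mod (e i : ℕ) b
          omega
        have hle : (e i : ℕ) / b ≤ e i := Nat.div_le_self _ _
        have hp := he ⟨(e i : ℕ) / b, by omega⟩ (by simp only; omega)
        simp only at hp
        rw [hq, ← Fin.ext_iff, e.injective.eq_iff, Fin.ext_iff] at hp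
        simp only at hp
        rw [← hp, hq]
        exact ⟨(e i).2, h1 ▸ (f j).2⟩
    have hsm : C • rectDiag k s τ = rectDiag k s (fun p => C * τ p) := by
      ext i j
      simp [rectDiag]
    have hC' : C * nrm (rectDiag k s τ) = nrm (C • rectDiag k s τ) := by
      rw [hn.2.1, abs_of_nonneg hC]
    rw [← hu.map_submatrix e f, hsub, hC', hsm]
    apply rectDiag_le hn hu
    · intro p
      split_ifs
      exacts [h0 _, le_rfl]
    · intro p
      split_ifs with hp
      · exact (hσ (Nat.le_add_right _ _)).trans (h p (by omega) (by omega))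
      · exact mul_nonneg hC (hτ p)
  calc nrm (rectDiag k s σ) ≤ ∑ a ∈ Finset.range b, nrm (P a) := hsum ▸ hn.map_sum_le _ _
    _ ≤ ∑ a ∈ Finset.range b, C * nrm (rectDiag k s τ) := Finset.sum_le_sum hP
    _ = b * (C * nrm (rectDiag k s τ)) := by simp

theorem OrthonormalBasis.matrix_mul_transpose_eq_one {n : ℕ}
    (b : OrthonormalBasis (Fin n) ℝ (EuclideanSpace ℝ (Fin n))) :
    (Matrix.of fun p j => b p j) * (Matrix.of fun p j => b p j)ᵀ =
      (1 : Matrix (Fin n) (Fin n) ℝ) := by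
  ext p q
  have h := orthonormal_iff_ite.1 b.orthonormal q p
  simp only [PiLp.inner_apply, RCLike.inner_apply, conj_trivial] at h
  simp only [Matrix.mul_apply, Matrix.transpose_apply, Matrix.of_apply, Matrix.one_apply]
  rw [h]
  simp [eq_comm]

/-- Singular value decomposition of a real rectangular matrix, with sorted singular values. -/
theorem exists_svd {k s : ℕ} (A : Matrix (Fin k) (Fin s) ℝ) :
    ∃ (U : Matrix (Fin k) (Fin k) ℝ) (V : Matrix (Fin s) (Fin s) ℝ) (σ : ℕ → ℝ),
      U * Uᵀ = 1 ∧ V * Vᵀ = 1 ∧ Antitone σ ∧ (∀ p, 0 ≤ σ p) ∧ (∀ p, k ≤ p → σ p = 0) ∧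
      A = U * rectDiag k s σ * V := by
  let T := Matrix.toEuclideanLin A
  have hs : Module.finrank ℝ (EuclideanSpace ℝ (Fin s)) = s := by simp
  let v := T.isSymmetric_adjoint_comp_self.eigenvectorBasis hs
  have hrk : Module.finrank ℝ T.range ≤ k := by
    simpa using Submodule.finrank_le T.range
  have hk0 : ∀ p, k ≤ p → T.singularValues p = 0 := fun p hp =>
    T.singularValues_eq_zero_iff_le_finrank_range.2 (hrk.trans hp)
  have hs0 : ∀ p, s ≤ p → T.singularValues p = 0 := fun p hp =>
    T.singularValues_of_finrank_le (hs.le.trans hp)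
  have hinner : ∀ i j, inner ℝ (T (v i)) (T (v j)) =
      if i = j then T.singularValues j ^ 2 else 0 := by
    intro i j
    rw [← LinearMap.adjoint_inner_right]
    have h1 := T.isSymmetric_adjoint_comp_self.apply_eigenvectorBasis hs j
    rw [LinearMap.comp_apply] at h1
    rw [h1, inner_smul_right, orthonormal_iff_ite.1 v.orthonormal, T.sq_singularValues_fin hs]
    simp
  let w : Fin k → EuclideanSpace ℝ (Fin k) := fun i =>
    if h : (i : ℕ) < s then (T.singularValues i)⁻¹ • T (v ⟨i, h⟩) else 0
  let S : Set (Fin k) := {i | T.singularValues i ≠ 0}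
  have hlt : ∀ i ∈ S, (i : ℕ) < s := fun i hi => by
    by_contra hc
    exact hi (hs0 _ (not_lt.1 hc))
  have hw : Orthonormal ℝ (S.domRestrict w) := by
    rw [orthonormal_iff_ite]
    rintro ⟨i, hi⟩ ⟨j, hj⟩
    have hi' : T.singularValues i ≠ 0 := hi
    simp only [Set.domRestrict_apply, w, hlt i hi, hlt j hj, dif_pos, inner_smul_left,
      inner_smul_right, hinner, Subtype.mk.injEq, Fin.ext_iff]
    split_ifs with hij
    · rw [← hij]
      simp
      field_simp
    · simp
  obtain ⟨b, hb⟩ := hw.exists_orthonormalBasis_extension_of_card_eq (by simp)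
  have hTv : ∀ j : Fin s, T (v j) =
      if h : (j : ℕ) < k then T.singularValues j • b ⟨j, h⟩ else 0 := by
    intro j
    by_cases h0 : T.singularValues j = 0
    · have h1 : T (v j) = 0 := by
        rw [← inner_self_eq_zero (𝕜 := ℝ), hinner]
        simp [h0]
      simp [h1, h0]
    · have hjk : (j : ℕ) < k := by
        by_contra hc
        exact h0 (hk0 _ (not_lt.1 hc))
      rw [dif_pos hjk, hb ⟨j, hjk⟩ h0]
      simp [w, h0]
  let U : Matrix (Fin k) (Fin k) ℝ := Matrix.of fun p j => b p j
  let V : Matrix (Fin s) (Fin s) ℝ := Matrix.of fun p j => v p j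
  have hU : U * Uᵀ = 1 := b.matrix_mul_transpose_eq_one
  have hV : V * Vᵀ = 1 := v.matrix_mul_transpose_eq_one
  have hAV : A * Vᵀ = Uᵀ * rectDiag k s T.singularValues := by
    ext i j
    have h1 : (A * Vᵀ) i j = T (v j) i := by
      simp [T, V, Matrix.mul_apply, Matrix.mulVec, dotProduct]
    rw [h1, hTv]
    simp only [Matrix.mul_apply, rectDiag, Matrix.of_apply, Matrix.transpose_apply, U]
    split_ifs with h
    · rw [Finset.sum_eq_single ⟨j, h⟩]
      · simp [mul_comm]
      · intro q _ hq
        rw [if_neg (fun hc => hq (Fin.ext hc)), mul_zero]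
      · simp
    · rw [Finset.sum_eq_zero]
      · simp
      · intro q _
        rw [if_neg (fun hc : (q : ℕ) = j => h (hc ▸ q.2)), mul_zero]
  refine ⟨Uᵀ, V, T.singularValues, ?_, hV, T.singularValues_antitone, T.singularValues_nonneg,
    hk0, ?_⟩
  · rw [Matrix.transpose_transpose]
    exact mul_eq_one_comm.1 hU
  · rw [← hAV, Matrix.mul_assoc, mul_eq_one_comm.1 hV, Matrix.mul_one]

theorem sum_sq_mulVec_of_orthogonal {n : ℕ} {V : Matrix (Fin n) (Fin n) ℝ} (hV : V * Vᵀ = 1)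
    (x : Fin n → ℝ) : ∑ i, (V *ᵥ x) i ^ 2 = ∑ i, x i ^ 2 := by
  have h : (V *ᵥ x) ⬝ᵥ (V *ᵥ x) = x ⬝ᵥ x := by
    rw [Matrix.dotProduct_mulVec, Matrix.vecMul_mulVec, mul_eq_one_comm.1 hV, Matrix.vecMul_one]
  simpa [dotProduct, sq] using h

/-- One half of the Courant–Fischer principle: a coordinate subspace of dimension more than `p`
on which a matrix is bounded below by `t` forces its `p`-th singular value to be at least `t`. -/
theorem le_singularValue_of_coord_subspace {k s : ℕ} {U : Matrix (Fin k) (Fin k) ℝ}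
    {V : Matrix (Fin s) (Fin s) ℝ} {τ : ℕ → ℝ} (hU : U * Uᵀ = 1) (hV : V * Vᵀ = 1)
    (hτ : Antitone τ) (hτ0 : ∀ p, 0 ≤ τ p) (J : Finset (Fin s)) {p : ℕ} (hp : p < J.card) {t : ℝ}
    (h : ∀ x : Fin s → ℝ, (∀ j ∉ J, x j = 0) →
      t ^ 2 * ∑ j, x j ^ 2 ≤ ∑ i, ((U * rectDiag k s τ * V) *ᵥ x) i ^ 2) :
    t ≤ τ p := by
  have hps : J.card ≤ s := by simpa using J.card_le_univ
  let E : (J → ℝ) →ₗ[ℝ] (Fin s → ℝ) := Function.ExtendByZero.linearMap ℝ (Subtype.val : J → Fin s)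
  let R : (Fin s → ℝ) →ₗ[ℝ] (Fin p → ℝ) :=
    LinearMap.funLeft ℝ ℝ (fun q : Fin p => (⟨q, by omega⟩ : Fin s))
  have hker : LinearMap.ker (R ∘ₗ V.mulVecLin ∘ₗ E) ≠ ⊥ := by
    apply LinearMap.ker_ne_bot_of_finrank_lt
    simpa using hp
  obtain ⟨y, hy, hy0⟩ := Submodule.exists_mem_ne_zero_of_ne_bot hker
  let x := E y
  have hxval : ∀ j : J, x j = y j := fun j =>
    Function.Injective.extend_apply Subtype.val_injective _ _ _
  have hxJ : ∀ j ∉ J, x j = 0 := fun j hj =>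
    Function.extend_apply' _ _ _ (by rintro ⟨a, rfl⟩; exact hj a.2)
  have hz : ∀ q : Fin s, (q : ℕ) < p → (V *ᵥ x) q = 0 := fun q hq => by
    simpa using! congrFun (LinearMap.mem_ker.1 hy) ⟨q, hq⟩
  have hpos : 0 < ∑ j, x j ^ 2 := by
    obtain ⟨j, hj⟩ := Function.ne_iff.1 hy0
    refine Finset.sum_pos' (fun _ _ => sq_nonneg _) ⟨j, Finset.mem_univ _, ?_⟩
    rw [hxval]
    exact sq_pos_of_ne_zero hj
  have hdiag : ∀ z : Fin s → ℝ, (∀ q : Fin s, (q : ℕ) < p → z q = 0) →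
      ∑ i, (rectDiag k s τ *ᵥ z) i ^ 2 ≤ τ p ^ 2 * ∑ j, z j ^ 2 := by
    intro z hz
    have hrow : ∀ i, (rectDiag k s τ *ᵥ z) i ^ 2
        = ∑ j : Fin s, if (i : ℕ) = j then τ i ^ 2 * z j ^ 2 else 0 := by
      intro i
      simp only [Matrix.mulVec, dotProduct, rectDiag, Matrix.of_apply]
      by_cases hi : (i : ℕ) < s
      · rw [Finset.sum_eq_single ⟨i, hi⟩, Finset.sum_eq_single ⟨i, hi⟩]
        · simp [mul_pow]
        · intro q _ hq
          exact if_neg fun hc => hq (Fin.ext hc.symm)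
        · simp
        · intro q _ hq
          rw [if_neg fun hc => hq (Fin.ext hc.symm), zero_mul]
        · simp
      · have : ∀ j : Fin s, (i : ℕ) ≠ j := fun j hc => hi (hc ▸ j.2)
        simp [this]
    simp only [hrow]
    rw [Finset.sum_comm, Finset.mul_sum]
    refine Finset.sum_le_sum fun j _ => ?_
    by_cases hj : (j : ℕ) < p
    · simp [hz j hj]
    · by_cases hjk : (j : ℕ) < k
      · rw [Finset.sum_eq_single ⟨j, hjk⟩]
        · simp only [if_true]
          have := hτ0 j
          have := hτ (not_lt.1 hj)
          gcongr
        · intro q _ hq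
          exact if_neg fun hc => hq (Fin.ext hc)
        · simp
      · rw [Finset.sum_eq_zero]
        · positivity
        · intro q _
          exact if_neg fun hc : (q : ℕ) = j => hjk (hc ▸ q.2)
  have h1 := h x hxJ
  rw [← Matrix.mulVec_mulVec, ← Matrix.mulVec_mulVec, sum_sq_mulVec_of_orthogonal hU] at h1
  have h2 := h1.trans (hdiag _ hz)
  rw [sum_sq_mulVec_of_orthogonal hV] at h2
  exact le_of_sq_le_sq (le_of_mul_le_mul_right h2 hpos) (hτ0 p)

theorem sq_sum_eq_sum_sq_of_mul_eq_zero {ι : Type*} [Fintype ι] {f : ι → ℝ}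
    (h : ∀ i j, i ≠ j → f i * f j = 0) : (∑ i, f i) ^ 2 = ∑ i, f i ^ 2 := by
  rw [sq, Finset.sum_mul_sum]
  refine Finset.sum_congr rfl fun i _ => ?_
  rw [Finset.sum_eq_single i (fun j _ hj => h i j hj.symm) (by simp), sq]

/-- If more than `p` columns of a matrix have pairwise disjoint supports and norm at least `t`,
then its `p`-th singular value is at least `t`. -/
theorem le_singularValue_of_disjoint_columns {k s : ℕ} {Y : Matrix (Fin k) (Fin s) ℝ}
    {U : Matrix (Fin k) (Fin k) ℝ} {V : Matrix (Fin s) (Fin s) ℝ} {τ : ℕ → ℝ}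
    (hU : U * Uᵀ = 1) (hV : V * Vᵀ = 1) (hτ : Antitone τ) (hτ0 : ∀ p, 0 ≤ τ p)
    (hY : Y = U * rectDiag k s τ * V) (J : Finset (Fin s)) {p : ℕ} (hp : p < J.card) {t : ℝ}
    (hdis : ∀ i, ∀ j ∈ J, ∀ j' ∈ J, j ≠ j' → Y i j * Y i j' = 0)
    (hcol : ∀ j ∈ J, t ^ 2 ≤ ∑ i, Y i j ^ 2) : t ≤ τ p := by
  refine le_singularValue_of_coord_subspace hU hV hτ hτ0 J hp fun x hx => ?_
  rw [← hY]
  have hrow : ∀ i, (Y *ᵥ x) i ^ 2 = ∑ j, Y i j ^ 2 * x j ^ 2 := by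
    intro i
    simp only [Matrix.mulVec, dotProduct]
    rw [sq_sum_eq_sum_sq_of_mul_eq_zero]
    · simp only [mul_pow]
    · intro j j' hjj
      by_cases hj : j ∈ J
      · by_cases hj' : j' ∈ J
        · linear_combination (x j * x j') * hdis i j hj j' hj' hjj
        · simp [hx j' hj']
      · simp [hx j hj]
  simp only [hrow]
  rw [Finset.sum_comm, Finset.mul_sum]
  refine Finset.sum_le_sum fun j _ => ?_
  rw [← Finset.sum_mul]
  by_cases hj : j ∈ J
  · exact mul_le_mul_of_nonneg_right (hcol j hj) (sq_nonneg _)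
  · simp [hx j hj]

theorem card_filter_mod_mul_le {k m r : ℕ} (hmk : m ≤ k) (B : Finset (Fin k)) :
    (B.filter fun i : Fin k => (i : ℕ) % m = r).card * m ≤ 2 * k := by
  have h1 : (B.filter fun i : Fin k => (i : ℕ) % m = r).card ≤ k / m + 1 := by
    rw [← Finset.card_range (k / m + 1)]
    refine Finset.card_le_card_of_injOn (fun i => (i : ℕ) / m) ?_ ?_
    · intro i _
      simp only [Finset.coe_range, Set.mem_Iio]
      exact Nat.lt_succ_of_le (Nat.div_le_div_right i.2.le)
    · intro i hi j hj hij
      simp only [Finset.coe_filter, Set.mem_ofPred_eq] at hi hj hij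
      rw [Fin.ext_iff, ← Nat.div_add_mod (i : ℕ) m, ← Nat.div_add_mod (j : ℕ) m, hij, hi.2, hj.2]
  have h2 := Nat.div_mul_le_self k m
  nlinarith

/-- If `B` contains at least half of `{0, …, k - 1}`, then at least an eighth of the residue
classes modulo `m ≤ k` meet `B` in at least `k / (4 * m)` elements. -/
theorem le_card_filter_residues {k m : ℕ} (hm : 0 < m) (hmk : m ≤ k) {B : Finset (Fin k)}
    (hB : k ≤ 2 * B.card) :
    m ≤ 8 * ((Finset.range m).filter fun r =>
      k ≤ 4 * m * (B.filter fun i : Fin k => (i : ℕ) % m = r).card).card := by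
  set R := (Finset.range m).filter fun r =>
      k ≤ 4 * m * (B.filter fun i : Fin k => (i : ℕ) % m = r).card with hR
  have hsum : B.card = ∑ r ∈ Finset.range m, (B.filter fun i : Fin k => (i : ℕ) % m = r).card :=
    Finset.card_eq_sum_card_fiberwise fun i _ => by
      simpa using Nat.mod_lt _ hm
  have hterm : ∀ r ∈ Finset.range m,
      4 * m * (B.filter fun i : Fin k => (i : ℕ) % m = r).card ≤
        k + if r ∈ R then 8 * k else 0 := by
    intro r hr
    split_ifs with h
    · have := card_filter_mod_mul_le (r := r) hmk B
      nlinarith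
    · have : ¬ k ≤ 4 * m * (B.filter fun i : Fin k => (i : ℕ) % m = r).card := fun hc =>
        h (Finset.mem_filter.2 ⟨hr, hc⟩)
      omega
  have h1 := Finset.sum_le_sum hterm
  rw [← Finset.mul_sum, ← hsum, Finset.sum_add_distrib, ← Finset.sum_filter,
    Finset.sum_const, Finset.sum_const, Finset.card_range,
    Finset.filter_mem_eq_inter, Finset.inter_eq_right.2 (Finset.filter_subset _ _)] at h1
  rw [← hR] at h1
  simp only [smul_eq_mul] at h1
  have hk : 0 < k := by omega
  have h2 : m * k ≤ (8 * R.card) * k := by nlinarith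
  exact Nat.le_of_mul_le_mul_right h2 hk

/-- The columns with index `j` in the dyadic block `2 ^ l ≤ j + 1 < 2 ^ (l + 1)` are constant
multiples of the indicators of the residue classes modulo `2 ^ l`, of norm at most `σ j`. -/
noncomputable def dyadicSpread (k s : ℕ) (σ : ℕ → ℝ) : Matrix (Fin k) (Fin s) ℝ :=
  Matrix.of fun i j =>
    if (i : ℕ) % 2 ^ Nat.log 2 (j + 1) = (j + 1) % 2 ^ Nat.log 2 (j + 1) then
      √(2 ^ Nat.log 2 (j + 1) / (2 * k)) * σ j
    else 0

theorem sum_sq_rowRestrict_dyadicSpread {k s : ℕ} (σ : ℕ → ℝ) (B : Finset (Fin k)) (j : Fin s) :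
    ∑ i, rowRestrict B (dyadicSpread k s σ) i j ^ 2 =
      (B.filter fun i : Fin k =>
        (i : ℕ) % 2 ^ Nat.log 2 (j + 1) = (j + 1) % 2 ^ Nat.log 2 (j + 1)).card *
      (2 ^ Nat.log 2 (j + 1) / (2 * k) * σ j ^ 2) := by
  have hsq : √((2 : ℝ) ^ Nat.log 2 (j + 1) / (2 * k)) ^ 2 = 2 ^ Nat.log 2 (j + 1) / (2 * k) :=
    Real.sq_sqrt (by positivity)
  simp only [rowRestrict, dyadicSpread, Matrix.of_apply, ite_pow, mul_pow, hsq]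
  rw [← Finset.sum_filter_add_sum_filter_not Finset.univ (· ∈ B)]
  rw [Finset.sum_congr rfl fun i hi => if_pos (Finset.mem_filter.1 hi).2,
    Finset.sum_congr (s₁ := Finset.filter (· ∉ B) _) rfl
      fun i hi => if_neg (Finset.mem_filter.1 hi).2]
  simp [← Finset.sum_filter]

theorem rowRestrict_univ {k s : ℕ} (A : Matrix (Fin k) (Fin s) ℝ) :
    rowRestrict Finset.univ A = A := by
  ext i j
  simp [rowRestrict]

theorem rowRestrict_mul {k s : ℕ} (B : Finset (Fin k)) (A : Matrix (Fin k) (Fin s) ℝ)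
    (V : Matrix (Fin s) (Fin s) ℝ) : rowRestrict B (A * V) = rowRestrict B A * V := by
  ext i j
  simp only [rowRestrict, Matrix.mul_apply, Matrix.of_apply]
  split_ifs <;> simp

theorem sum_sq_dyadicSpread_le {k s : ℕ} {σ : ℕ → ℝ} (hσ : ∀ p, k ≤ p → σ p = 0) (j : Fin s) :
    ∑ i, dyadicSpread k s σ i j ^ 2 ≤ σ j ^ 2 := by
  have h := sum_sq_rowRestrict_dyadicSpread (k := k) σ Finset.univ j
  rw [rowRestrict_univ] at h
  rw [h]
  by_cases hj : (j : ℕ) < k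
  · have hlog : 2 ^ Nat.log 2 ((j : ℕ) + 1) ≤ k := (Nat.pow_log_le_self 2 (by omega)).trans hj
    have hcard := card_filter_mod_mul_le (r := ((j : ℕ) + 1) % 2 ^ Nat.log 2 ((j : ℕ) + 1))
      hlog Finset.univ
    rw [← mul_assoc]
    refine mul_le_of_le_one_left (sq_nonneg _) ?_
    have hk : (0 : ℝ) < 2 * k := by
      have : 0 < k := by omega
      positivity
    rw [mul_div_assoc', div_le_one hk]
    exact_mod_cast hcard
  · simp [hσ j (not_lt.1 hj)]

theorem rowRestrict_dyadicSpread_mul_eq_zero {k s : ℕ} (σ : ℕ → ℝ) (B : Finset (Fin k)) (i : Fin k)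
    {j j' : Fin s} (hlog : Nat.log 2 ((j : ℕ) + 1) = Nat.log 2 ((j' : ℕ) + 1)) (hne : j ≠ j') :
    rowRestrict B (dyadicSpread k s σ) i j * rowRestrict B (dyadicSpread k s σ) i j' = 0 := by
  have hmod : ((j : ℕ) + 1) % 2 ^ Nat.log 2 ((j : ℕ) + 1) ≠
      ((j' : ℕ) + 1) % 2 ^ Nat.log 2 ((j : ℕ) + 1) := by
    intro h
    have hdiv : ∀ n : ℕ, n ≠ 0 → n / 2 ^ Nat.log 2 n = 1 := fun n hn =>
      Nat.div_eq_of_lt_le (by simpa using Nat.pow_log_le_self 2 hn)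
        (by simpa [pow_succ'] using Nat.lt_pow_succ_log_self one_lt_two n)
    have h1 := Nat.div_add_mod ((j : ℕ) + 1) (2 ^ Nat.log 2 ((j : ℕ) + 1))
    have h2 := Nat.div_add_mod ((j' : ℕ) + 1) (2 ^ Nat.log 2 ((j' : ℕ) + 1))
    rw [hdiv _ (by omega)] at h1 h2
    rw [← hlog] at h2
    exact hne (Fin.ext (by omega))
  simp only [rowRestrict, dyadicSpread, Matrix.of_apply, ← hlog]
  split_ifs with h1 h2 h3
  · exact absurd (h2.symm.trans h3) hmod
  all_goals simp

theorem exists_dyadic_scale (p : ℕ) : ∃ l : ℕ, 8 * p < 2 ^ l ∧ 2 * 2 ^ l - 2 ≤ 32 * p := by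
  rcases Nat.eq_zero_or_pos p with rfl | hp
  · exact ⟨0, by simp⟩
  · refine ⟨Nat.log 2 (8 * p) + 1, Nat.lt_pow_succ_log_self one_lt_two _, ?_⟩
    have := Nat.pow_log_le_self 2 (x := 8 * p) (by omega)
    rw [pow_succ]
    omega

/-- The singular values of any restriction of `dyadicSpread k s σ` to half of its rows dominate a
dilate of the sequence `σ`, up to a factor `3`. -/
theorem le_singularValue_rowRestrict_dyadicSpread {k s : ℕ} {σ : ℕ → ℝ} (hσ : Antitone σ)
    (hσ0 : ∀ p, 0 ≤ σ p) {B : Finset (Fin k)} (hB : k ≤ 2 * B.card)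
    {U : Matrix (Fin k) (Fin k) ℝ} {V : Matrix (Fin s) (Fin s) ℝ} {τ : ℕ → ℝ}
    (hU : U * Uᵀ = 1) (hV : V * Vᵀ = 1) (hτ : Antitone τ) (hτ0 : ∀ p, 0 ≤ τ p)
    (hY : rowRestrict B (dyadicSpread k s σ) = U * rectDiag k s τ * V) {p : ℕ}
    (hpk : 32 * p < k) (hps : 32 * p < s) : σ (32 * p) ≤ 3 * τ p := by
  obtain ⟨l, hl1, hl2⟩ := exists_dyadic_scale p
  have hm : 0 < 2 ^ l := by positivity
  have hmk : 2 ^ l ≤ k := by omega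
  let N : ℕ → ℕ := fun r => (B.filter fun i : Fin k => (i : ℕ) % 2 ^ l = r).card
  let J : Finset (Fin s) := Finset.univ.filter fun j =>
    Nat.log 2 ((j : ℕ) + 1) = l ∧ k ≤ 4 * 2 ^ l * N (((j : ℕ) + 1) % 2 ^ l)
  have hR := le_card_filter_residues hm hmk hB
  have hJ : ((Finset.range (2 ^ l)).filter fun r => k ≤ 4 * 2 ^ l * N r).card ≤ J.card := by
    have hlt : ∀ r ∈ (Finset.range (2 ^ l)).filter fun r => k ≤ 4 * 2 ^ l * N r,
        2 ^ l - 1 + r < s := by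
      intro r hr
      have := Finset.mem_range.1 (Finset.mem_filter.1 hr).1
      omega
    refine Finset.card_le_card_of_injective
      (f := fun r => (⟨⟨2 ^ l - 1 + r.1, hlt _ r.2⟩, ?_⟩ : J)) ?_
    · obtain ⟨r, hr⟩ := r
      obtain ⟨hr1, hr2⟩ := Finset.mem_filter.1 hr
      have hr1 := Finset.mem_range.1 hr1
      have hadd : 2 ^ l - 1 + r + 1 = 2 ^ l + r := by omega
      simp only [J, Finset.mem_filter, Finset.mem_univ, true_and, hadd]
      refine ⟨Nat.log_eq_of_pow_le_of_lt_pow (by omega) (by rw [pow_succ]; omega), ?_⟩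
      rwa [Nat.add_mod_left, Nat.mod_eq_of_lt hr1]
    · rintro ⟨r, hr⟩ ⟨r', hr'⟩ h
      simp only [Subtype.mk.injEq, Fin.mk.injEq] at h ⊢
      omega
  have hpJ : p < J.card := by
    have : 2 ^ l ≤ 8 * ((Finset.range (2 ^ l)).filter fun r => k ≤ 4 * 2 ^ l * N r).card := hR
    omega
  have hmain : σ (32 * p) / 3 ≤ τ p := by
    refine le_singularValue_of_disjoint_columns hU hV hτ hτ0 hY J hpJ ?_ ?_
    · intro i j hj j' hj' hne
      have h1 := (Finset.mem_filter.1 hj).2.1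
      have h2 := (Finset.mem_filter.1 hj').2.1
      exact rowRestrict_dyadicSpread_mul_eq_zero σ B i (h1.trans h2.symm) hne
    · intro j hj
      obtain ⟨h1, h2⟩ := (Finset.mem_filter.1 hj).2
      rw [sum_sq_rowRestrict_dyadicSpread, h1]
      have hj32 : (j : ℕ) ≤ 32 * p := by
        have := Nat.lt_pow_succ_log_self one_lt_two ((j : ℕ) + 1)
        rw [h1, pow_succ] at this
        omega
      have hσj : σ (32 * p) ^ 2 ≤ σ j ^ 2 := by
        have := hσ hj32
        have := hσ0 (32 * p)
        gcongr
      have hk : (0 : ℝ) < k := by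
        have : 0 < k := by omega
        positivity
      have hN : (1 : ℝ) / 8 ≤ N (((j : ℕ) + 1) % 2 ^ l) * (2 ^ l / (2 * k)) := by
        have h3 : (k : ℝ) ≤ 4 * 2 ^ l * N (((j : ℕ) + 1) % 2 ^ l) := by exact_mod_cast h2
        rw [mul_div_assoc', div_le_div_iff₀ (by norm_num) (by positivity)]
        linarith
      rw [← mul_assoc]
      have := mul_le_mul_of_nonneg_right hN (sq_nonneg (σ j))
      have := sq_nonneg (σ j)
      change _ ≤ (N (((j : ℕ) + 1) % 2 ^ l) : ℝ) * (2 ^ l / (2 * k)) * σ j ^ 2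
      linarith [div_pow (σ (32 * p)) 3 2]
  linarith

theorem frobNorm_transpose {k s : ℕ} (A : Matrix (Fin k) (Fin s) ℝ) :
    frobNorm Aᵀ = frobNorm A := by
  simp only [frobNorm, Matrix.transpose_apply]
  rw [Finset.sum_comm]

theorem frobNorm_mul_left {k s : ℕ} {U : Matrix (Fin k) (Fin k) ℝ} (hU : U * Uᵀ = 1)
    (A : Matrix (Fin k) (Fin s) ℝ) : frobNorm (U * A) = frobNorm A := by
  rw [← frobNorm_transpose, ← frobNorm_transpose A]
  simp only [frobNorm, Matrix.transpose_apply]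
  congr 1
  exact Finset.sum_congr rfl fun j _ => sum_sq_mulVec_of_orthogonal hU fun i => A i j

theorem frobNorm_mul_right {k s : ℕ} {V : Matrix (Fin s) (Fin s) ℝ} (hV : V * Vᵀ = 1)
    (A : Matrix (Fin k) (Fin s) ℝ) : frobNorm (A * V) = frobNorm A := by
  rw [← frobNorm_transpose, Matrix.transpose_mul, frobNorm_mul_left, frobNorm_transpose]
  rw [Matrix.transpose_transpose]
  exact mul_eq_one_comm.1 hV

theorem frobNorm_dyadicSpread_le {k s : ℕ} {σ : ℕ → ℝ} (hσ : ∀ p, k ≤ p → σ p = 0) :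
    frobNorm (dyadicSpread k s σ) ≤ frobNorm (rectDiag k s σ) := by
  refine Real.sqrt_le_sqrt ?_
  rw [Finset.sum_comm, Finset.sum_comm (f := fun i j => rectDiag k s σ i j ^ 2)]
  refine Finset.sum_le_sum fun j _ => (sum_sq_dyadicSpread_le hσ j).trans ?_
  by_cases hj : (j : ℕ) < k
  · refine le_trans (le_of_eq ?_) (Finset.single_le_sum
      (f := fun i => rectDiag k s σ i j ^ 2) (fun _ _ => sq_nonneg _) (Finset.mem_univ ⟨j, hj⟩))
    simp [rectDiag]
  · rw [hσ j (not_lt.1 hj), zero_pow two_ne_zero]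
    positivity

/-- Norm dispersion lemma: there is an absolute constant `c₀ ∈ (0,1)`
such that for all integers `k ≥ 50`, `s ≥ 1` and every `D ∈ ℝ^{k×s}` there is a
`W ∈ ℝ^{k×s}` with `‖W‖_F ≤ ‖D‖_F` such that for every `B ⊆ {1,…,k}` with
`|B| = ⌊(1 − c₀)k⌋` and every unitarily invariant norm, `‖W^{(B)}‖ ≥ c₀‖D‖`. -/
theorem norm_dispersion :
    ∃ c₀ : ℝ, 0 < c₀ ∧ c₀ < 1 ∧
      ∀ (k s : ℕ), 50 ≤ k → 1 ≤ s →
        ∀ D : Matrix (Fin k) (Fin s) ℝ,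
          ∃ W : Matrix (Fin k) (Fin s) ℝ,
            frobNorm W ≤ frobNorm D ∧
            ∀ B : Finset (Fin k), B.card = ⌊(1 - c₀) * (k : ℝ)⌋₊ →
              ∀ nrm : Matrix (Fin k) (Fin s) ℝ → ℝ,
                IsMatrixNorm nrm → IsUnitarilyInvariant nrm →
                c₀ * nrm D ≤ nrm (rowRestrict B W) := by
  refine ⟨1 / 100, by norm_num, by norm_num, fun k s hk _ D => ?_⟩
  obtain ⟨U, V, σ, hU, hV, hσ, hσ0, hσk, hD⟩ := exists_svd D
  refine ⟨dyadicSpread k s σ * V, ?_, fun B hB nrm hn hu => ?_⟩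
  · rw [hD, frobNorm_mul_right hV, frobNorm_mul_right hV, frobNorm_mul_left hU]
    exact frobNorm_dyadicSpread_le hσk
  · have hBk : k ≤ 2 * B.card := by
      have hk' : (50 : ℝ) ≤ k := by exact_mod_cast hk
      have h := Nat.lt_floor_add_one ((1 - 1 / 100) * (k : ℝ))
      rw [← hB] at h
      have : (k : ℝ) ≤ 2 * B.card := by linarith
      exact_mod_cast this
    obtain ⟨U', V', τ, hU', hV', hτ, hτ0, -, hY⟩ := exists_svd (rowRestrict B (dyadicSpread k s σ))
    have hmain := IsUnitarilyInvariant.rectDiag_le_of_dilation hn hu hσ hσ0 hτ0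
      (b := 32) (by norm_num) (C := 3) (by norm_num)
      fun p => le_singularValue_rowRestrict_dyadicSpread hσ hσ0 hBk hU' hV' hτ hτ0 hY
    have h0 := hn.nonneg (rectDiag k s τ)
    rw [rowRestrict_mul, hu.map_mul_right hV, hY, hu U' V' _ hU' hV', hD, hu U V _ hU hV]
    push_cast at hmain
    linarith
end

section
/- (Minimax lower bound for Poisson rate matrix estimation under unitarily invariant norms) There exists an absolute constant c > 0 such that the following holds for all integers k, s ≥ 1, every λ > 0, and every unitarily invariant norm ‖·‖ on ℝ^{k×s}. Let Γ(k, s, λ) = { Λ ∈ ℝ^{k×s} : 0 ≤ Λ_{ij} ≤ λ for all i, j }, and for Λ ∈ Γ(k, s, λ) let P_Λ be the product measure on ℕ^{k×s} under which the entries X_{ij} are independent with X_{ij} ∼ Poisson(Λ_{ij}) (with Poisson(0) the Dirac mass at 0). Then inf_{Λ̂} sup_{Λ ∈ Γ(k,s,λ)} E_{P_Λ}[ ‖Λ̂(X) − Λ‖² ] ≥ c · max(k, s) · ‖I_r‖² · min(λ, λ²), where the infimum is over all measurable maps Λ̂ : ℕ^{k×s} → ℝ^{k×s}, r = min(k, s),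 and I_r ∈ ℝ^{k×s} is the matrix with ones in the entries (i, i) for 1 ≤ i ≤ r and zeros elsewhere. -/
open MeasureTheory ProbabilityTheory Matrix
open scoped ENNReal

/-- The `k × s` matrix with ones in the entries `(i, i)` for `i < r` and zeros elsewhere. -/
def Imat (k s r : ℕ) : Matrix (Fin k) (Fin s) ℝ :=
  Matrix.of fun i j => if (i : ℕ) = (j : ℕ) ∧ (i : ℕ) < r then 1 else 0

/-- The law of a `k × s` array of independent Poisson observations with rate matrix
`Λ` (entrywise; `Poisson(0)` is the Dirac mass at `0`). -/
noncomputable def poissonMatrixMeasure (k s : ℕ) (Λ : Matrix (Fin k) (Fin s) ℝ) :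
    Measure (Fin k → Fin s → ℕ) :=
  Measure.pi fun i => Measure.pi fun j => poissonMeasure (Λ i j).toNNReal

namespace IsMatrixNorm

variable {k s : ℕ} {nrm : Matrix (Fin k) (Fin s) ℝ → ℝ}

theorem map_zero_s17 (h : IsMatrixNorm nrm) : nrm 0 = 0 := by
  simpa using h.2.1 0 0

theorem map_neg (h : IsMatrixNorm nrm) (A : Matrix (Fin k) (Fin s) ℝ) : nrm (-A) = nrm A := by
  simpa using h.2.1 (-1) A

theorem nonneg_s17 (h : IsMatrixNorm nrm) (A : Matrix (Fin k) (Fin s) ℝ) : 0 ≤ nrm A := by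
  have h1 := h.1 A (-A)
  rw [add_neg_cancel, h.map_zero_s17, h.map_neg] at h1
  linarith

theorem sum_le (h : IsMatrixNorm nrm) {ι : Type*} (t : Finset ι)
    (f : ι → Matrix (Fin k) (Fin s) ℝ) : nrm (∑ i ∈ t, f i) ≤ ∑ i ∈ t, nrm (f i) := by
  classical
  induction t using Finset.induction_on with
  | empty => simp [h.map_zero_s17]
  | insert a t ha ih =>
    rw [Finset.sum_insert ha, Finset.sum_insert ha]
    exact (h.1 _ _).trans (by gcongr)

end IsMatrixNorm

/-- The rectangular matrix with `σ` on the main diagonal and zeros elsewhere. -/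
def rectDiagonal {k : ℕ} (s : ℕ) (σ : Fin k → ℝ) : Matrix (Fin k) (Fin s) ℝ :=
  Matrix.of fun i j => if (i : ℕ) = (j : ℕ) then σ i else 0

theorem rectDiagonal_mul_transpose {k s : ℕ} (hks : k ≤ s) (σ : Fin k → ℝ) :
    rectDiagonal s σ * (rectDiagonal s σ)ᵀ = Matrix.diagonal fun i => σ i ^ 2 := by
  ext i j
  rw [Matrix.mul_apply, Finset.sum_eq_single (Fin.castLE hks i)]
  · by_cases hij : i = j
    · subst hij; simp [rectDiagonal, sq]
    · have : (j : ℕ) ≠ i := fun h => hij (Fin.ext h.symm)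
      simp [rectDiagonal, hij, this]
  · intro l _ hl
    have : (i : ℕ) ≠ l := fun h => hl (Fin.ext h.symm)
    simp [rectDiagonal, this]
  · simp

theorem exists_singular_value_decomposition {k s : ℕ} (hks : k ≤ s)
    (M : Matrix (Fin k) (Fin s) ℝ) :
    ∃ (U : Matrix (Fin k) (Fin k) ℝ) (V : Matrix (Fin s) (Fin s) ℝ) (σ : Fin k → ℝ),
      U * Uᵀ = 1 ∧ V * Vᵀ = 1 ∧ (∀ i, 0 ≤ σ i) ∧ M = U * rectDiagonal s σ * V := by
  have hA : (M * Mᵀ).IsHermitian := by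
    simpa [Matrix.conjTranspose_eq_transpose_of_trivial] using
      Matrix.isHermitian_mul_conjTranspose_self M
  set U : Matrix (Fin k) (Fin k) ℝ := (hA.eigenvectorUnitary).1 with hU
  have hUU : U * Uᵀ = 1 := by
    have := Unitary.coe_mul_star_self hA.eigenvectorUnitary
    rwa [Unitary.coe_star, Matrix.star_eq_conjTranspose, Matrix.conjTranspose_eq_transpose_of_trivial] at this
  have hUU' : Uᵀ * U = 1 := mul_eq_one_comm.mp hUU
  have hspec : M * Mᵀ = U * Matrix.diagonal hA.eigenvalues * Uᵀ := by
    have := hA.spectral_theorem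
    rw [Unitary.conjStarAlgAut_apply, Matrix.star_eq_conjTranspose,
      Matrix.conjTranspose_eq_transpose_of_trivial] at this
    simpa using this
  have hd0 : ∀ i, 0 ≤ hA.eigenvalues i := Matrix.PosSemidef.eigenvalues_nonneg (by
    simpa [Matrix.conjTranspose_eq_transpose_of_trivial] using
      Matrix.posSemidef_self_mul_conjTranspose M)
  generalize hA.eigenvalues = d at hspec hd0
  set N := Uᵀ * M with hN
  have hNN : N * Nᵀ = Matrix.diagonal d := by
    rw [hN, Matrix.transpose_mul, Matrix.transpose_transpose, Matrix.mul_assoc,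
      ← Matrix.mul_assoc M, hspec]
    simp only [← Matrix.mul_assoc]
    rw [hUU', Matrix.one_mul, Matrix.mul_assoc, hUU', Matrix.mul_one]
  have hdot : ∀ i j, ∑ l, N i l * N j l = if i = j then d i else 0 := by
    intro i j
    have := congrFun (congrFun hNN i) j
    simpa [Matrix.mul_apply, Matrix.diagonal_apply] using this
  let v : Fin s → EuclideanSpace ℝ (Fin s) := fun j =>
    if h : (j : ℕ) < k then (√(d ⟨j, h⟩))⁻¹ • WithLp.toLp 2 (N ⟨j, h⟩) else 0
  let S : Set (Fin s) := {j | ∃ h : (j : ℕ) < k, d ⟨j, h⟩ ≠ 0}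
  have hv : Orthonormal ℝ (S.domRestrict v) := by
    rw [orthonormal_iff_ite]
    rintro ⟨i, hi, hdi⟩ ⟨j, hj, hdj⟩
    have h1 : (inner ℝ (v i) (v j) : ℝ) =
        (√(d ⟨i, hi⟩))⁻¹ * (√(d ⟨j, hj⟩))⁻¹ * ∑ l, N ⟨i, hi⟩ l * N ⟨j, hj⟩ l := by
      simp only [v, dif_pos hi, dif_pos hj, PiLp.inner_apply, PiLp.smul_apply, smul_eq_mul,
        Finset.mul_sum, RCLike.inner_apply, conj_trivial]
      exact Finset.sum_congr rfl fun l _ => by ring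
    simp only [Set.domRestrict_apply, Subtype.mk.injEq]
    rw [h1, hdot]
    by_cases hij : i = j
    · subst hij
      have := Real.mul_self_sqrt (hd0 ⟨i, hi⟩)
      have h2 : √(d ⟨i, hi⟩) ≠ 0 := (Real.sqrt_ne_zero (hd0 _)).mpr hdi
      simp only [if_true]
      nth_rewrite 3 [← this]
      field_simp
    · have : (⟨i, hi⟩ : Fin k) ≠ ⟨j, hj⟩ := fun h => hij (Fin.ext (Fin.mk.inj_iff.mp h))
      simp [hij, this]
  obtain ⟨b, hb⟩ := hv.exists_orthonormalBasis_extension_of_card_eq (by simp)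
  refine ⟨U, Matrix.of fun j l => b j l, fun i => √(d i), hUU, ?_, fun i => Real.sqrt_nonneg _, ?_⟩
  · ext i j
    have := orthonormal_iff_ite.mp b.orthonormal i j
    simp only [PiLp.inner_apply, RCLike.inner_apply, conj_trivial] at this
    simp only [Matrix.mul_apply, Matrix.of_apply, Matrix.transpose_apply, Matrix.one_apply]
    rw [← this]
    exact Finset.sum_congr rfl fun l _ => mul_comm _ _
  · have hNeq : N = rectDiagonal s (fun i => √(d i)) * Matrix.of fun j l => b j l := by
      ext i l
      rw [Matrix.mul_apply, Finset.sum_eq_single (Fin.castLE hks i)]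
      · simp only [rectDiagonal, Matrix.of_apply, Fin.val_castLE, if_true]
        by_cases hdi : d i = 0
        · have h0 := hdot i i
          rw [if_pos rfl, hdi, Finset.sum_eq_zero_iff_of_nonneg fun l _ => mul_self_nonneg _] at h0
          have := h0 l (Finset.mem_univ _)
          rw [hdi, Real.sqrt_zero, zero_mul]
          exact mul_self_eq_zero.mp this
        · have h2 : √(d i) ≠ 0 := (Real.sqrt_ne_zero (hd0 _)).mpr hdi
          rw [hb _ ⟨by simp, by simpa using hdi⟩]
          simp [v, h2]
      · intro j _ hj
        have : (i : ℕ) ≠ j := fun h => hj (Fin.ext h.symm)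
        simp [rectDiagonal, this]
      · simp
    rw [Matrix.mul_assoc, ← hNeq, hN, ← Matrix.mul_assoc, hUU, Matrix.one_mul]

theorem permMatrix_mul_transpose {n : ℕ} (e : Equiv.Perm (Fin n)) :
    e.permMatrix ℝ * (e.permMatrix ℝ)ᵀ = 1 := by
  rw [Matrix.transpose_permMatrix, ← Matrix.permMatrix_mul]
  simp

theorem IsUnitarilyInvariant.submatrix_perm {k s : ℕ} {nrm : Matrix (Fin k) (Fin s) ℝ → ℝ}
    (h : IsUnitarilyInvariant nrm) (A : Matrix (Fin k) (Fin s) ℝ) (e : Equiv.Perm (Fin k))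
    (f : Equiv.Perm (Fin s)) : nrm (A.submatrix e f) = nrm A := by
  have : A.submatrix e f = e.permMatrix ℝ * A * f⁻¹.permMatrix ℝ := by
    ext i j
    rw [PEquiv.toMatrix_toPEquiv_mul, PEquiv.mul_toMatrix_toPEquiv]
    rfl
  rw [this]
  exact h _ _ _ (permMatrix_mul_transpose e) (permMatrix_mul_transpose f⁻¹)

/-- Cyclic averaging of the diagonal compares any nonnegative diagonal with the identity. -/
theorem sum_mul_norm_Imat_le {k s : ℕ} (hk : 1 ≤ k) (hks : k ≤ s)
    {nrm : Matrix (Fin k) (Fin s) ℝ → ℝ} (hn : IsMatrixNorm nrm) (hu : IsUnitarilyInvariant nrm)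
    (σ : Fin k → ℝ) (hσ : ∀ i, 0 ≤ σ i) :
    (∑ i, σ i) * nrm (Imat k s (min k s)) ≤ k * nrm (rectDiagonal s σ) := by
  have : NeZero k := ⟨by omega⟩
  let e : Fin k ≃ {j : Fin s // (j : ℕ) < k} :=
    { toFun := fun i => ⟨Fin.castLE hks i, i.2⟩
      invFun := fun j => ⟨j.1, j.2⟩
      left_inv := fun i => rfl
      right_inv := fun j => rfl }
  have hsum : ∑ t : Fin k, (rectDiagonal s σ).submatrix (Equiv.addRight t)
      ((Equiv.addRight t).extendDomain e) = (∑ i, σ i) • Imat k s (min k s) := by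
    ext i j
    rw [Matrix.sum_apply, Matrix.smul_apply, smul_eq_mul]
    simp only [Matrix.submatrix_apply, rectDiagonal, Imat, Matrix.of_apply]
    by_cases hj : (j : ℕ) < k
    · have hval : ∀ t : Fin k, (((Equiv.addRight t).extendDomain e j : Fin s) : ℕ) =
          ((⟨j, hj⟩ + t : Fin k) : ℕ) := by
        intro t
        rw [Equiv.Perm.extendDomain_apply_subtype _ e hj]
        rfl
      simp only [hval, Equiv.coe_addRight, ← Fin.ext_iff, add_left_inj]
      by_cases hij : i = ⟨j, hj⟩
      · have h1 : (i : ℕ) = j := by rw [hij]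
        have h2 : (j : ℕ) < min k s := lt_min hj j.2
        simp only [if_pos hij, h1, h2, and_self, if_true, mul_one]
        exact Equiv.sum_comp (Equiv.addLeft i) σ
      · have h1 : (i : ℕ) ≠ j := fun h => hij (Fin.ext h)
        simp [hij, h1]
    · have h1 : (i : ℕ) ≠ j := fun h => hj (h ▸ i.2)
      have h2 : ∀ t : Fin k, ((i + t : Fin k) : ℕ) ≠ j := fun t h => hj (h ▸ (i + t).2)
      simp only [Equiv.Perm.extendDomain_apply_not_subtype _ e hj]
      simp [h1, h2]
  have h1 := hn.sum_le Finset.univ fun t : Fin k => (rectDiagonal s σ).submatrix (Equiv.addRight t)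
      ((Equiv.addRight t).extendDomain e)
  rw [hsum, hn.2.1, abs_of_nonneg (Finset.sum_nonneg fun i _ => hσ i)] at h1
  simp only [hu.submatrix_perm] at h1
  simpa using h1

theorem norm_lower_bound_of_le {k s : ℕ} (hk : 1 ≤ k) (hks : k ≤ s)
    {nrm : Matrix (Fin k) (Fin s) ℝ → ℝ} (hn : IsMatrixNorm nrm) (hu : IsUnitarilyInvariant nrm)
    (M : Matrix (Fin k) (Fin s) ℝ) {a : ℝ} (ha : 0 < a) :
    ((M * Mᵀ).trace / a - (M * Mᵀ * (M * Mᵀ)).trace / (4 * a ^ 3)) * nrm (Imat k s (min k s))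
      ≤ k * nrm M := by
  obtain ⟨U, V, σ, hU, hV, hσ, hM⟩ := exists_singular_value_decomposition hks M
  have hU' : Uᵀ * U = 1 := mul_eq_one_comm.mp hU
  have hMM : M * Mᵀ = U * Matrix.diagonal (fun i => σ i ^ 2) * Uᵀ := by
    rw [← rectDiagonal_mul_transpose hks, hM]
    simp only [Matrix.transpose_mul, Matrix.mul_assoc]
    rw [← Matrix.mul_assoc V, hV, Matrix.one_mul]
  have ht1 : (M * Mᵀ).trace = ∑ i, σ i ^ 2 := by
    rw [hMM, Matrix.trace_mul_comm, ← Matrix.mul_assoc, hU', Matrix.one_mul, Matrix.trace_diagonal]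
  have hMM2 : M * Mᵀ * (M * Mᵀ) = U * Matrix.diagonal (fun i => σ i ^ 2 * σ i ^ 2) * Uᵀ := by
    rw [hMM, ← Matrix.diagonal_mul_diagonal]
    simp only [Matrix.mul_assoc]
    rw [← Matrix.mul_assoc Uᵀ, hU', Matrix.one_mul]
  have ht2 : (M * Mᵀ * (M * Mᵀ)).trace = ∑ i, σ i ^ 2 * σ i ^ 2 := by
    rw [hMM2, Matrix.trace_mul_comm, ← Matrix.mul_assoc, hU', Matrix.one_mul, Matrix.trace_diagonal]
  have hMn : nrm M = nrm (rectDiagonal s σ) := by rw [hM]; exact hu U V _ hU hV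
  rw [hMn]
  refine le_trans ?_ (sum_mul_norm_Imat_le hk hks hn hu σ hσ)
  refine mul_le_mul_of_nonneg_right ?_ (hn.nonneg_s17 _)
  rw [ht1, ht2, Finset.sum_div, Finset.sum_div, ← Finset.sum_sub_distrib]
  refine Finset.sum_le_sum fun i _ => ?_
  have h0 := hσ i
  set x := σ i
  have hkey : 0 ≤ a * x * ((x + 12 / 5 * a) * (x - 6 / 5 * a) ^ 2
      + 8 / 25 * x * a ^ 2 + 68 / 125 * a ^ 3) := by positivity
  rw [div_sub_div _ _ ha.ne' (by positivity), div_le_iff₀ (by positivity)]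
  linarith

theorem transpose_Imat (k s : ℕ) : (Imat k s (min k s))ᵀ = Imat s k (min s k) := by
  ext i j
  simp only [Imat, Matrix.transpose_apply, Matrix.of_apply]
  congr 1
  rw [min_comm]
  exact propext ⟨fun h => ⟨h.1.symm, h.1 ▸ h.2⟩, fun h => ⟨h.1.symm, h.1 ▸ h.2⟩⟩

theorem norm_lower_bound {k s : ℕ} (hk : 1 ≤ k) (hs : 1 ≤ s)
    {nrm : Matrix (Fin k) (Fin s) ℝ → ℝ} (hn : IsMatrixNorm nrm) (hu : IsUnitarilyInvariant nrm)
    (M : Matrix (Fin k) (Fin s) ℝ) {a : ℝ} (ha : 0 < a) :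
    ((M * Mᵀ).trace / a - (M * Mᵀ * (M * Mᵀ)).trace / (4 * a ^ 3)) * nrm (Imat k s (min k s))
      ≤ min (k : ℝ) s * nrm M := by
  rcases le_total k s with hks | hsk
  · rw [min_eq_left (Nat.cast_le.mpr hks)]
    exact norm_lower_bound_of_le hk hks hn hu M ha
  · rw [min_eq_right (Nat.cast_le.mpr hsk)]
    have hn' : IsMatrixNorm fun A : Matrix (Fin s) (Fin k) ℝ => nrm Aᵀ :=
      ⟨fun A B => hn.1 _ _, fun c A => hn.2.1 c _, fun A hA => by
        simpa using congrArg Matrix.transpose (hn.2.2 _ hA)⟩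
    have hu' : IsUnitarilyInvariant fun A : Matrix (Fin s) (Fin k) ℝ => nrm Aᵀ := by
      intro U V A hU hV
      simp only [Matrix.transpose_mul, ← Matrix.mul_assoc]
      exact hu _ _ _ (by simpa using mul_eq_one_comm.mp hV) (by simpa using mul_eq_one_comm.mp hU)
    have := norm_lower_bound_of_le hs hsk hn' hu' Mᵀ ha
    simp only [Matrix.transpose_transpose, transpose_Imat] at this
    have h2 : (M * Mᵀ * (M * Mᵀ)).trace = (Mᵀ * M * (Mᵀ * M)).trace := by
      rw [Matrix.mul_assoc, Matrix.trace_mul_comm]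
      simp only [Matrix.mul_assoc]
    rwa [h2, Matrix.trace_mul_comm M]

theorem one_eighth_le_tsum_min_poisson {a b : ℝ} (ha : 0 ≤ a) (hb : 0 ≤ b)
    (hab : (√b - √a) ^ 2 ≤ 1) :
    ENNReal.ofReal (1 / 8) ≤ ∑' n : ℕ, min (poissonMeasure b.toNNReal {n})
      (poissonMeasure a.toNNReal {n}) := by
  set p : ℕ → ℝ := fun n => Real.exp (-a) * a ^ n / n.factorial with hp
  set q : ℕ → ℝ := fun n => Real.exp (-b) * b ^ n / n.factorial with hq
  have hps : HasSum p 1 := by simpa [ha] using hasSum_one_poissonMeasure a.toNNReal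
  have hqs : HasSum q 1 := by simpa [hb] using hasSum_one_poissonMeasure b.toNNReal
  have hp0 : ∀ n, 0 ≤ p n := fun n => by positivity
  have hq0 : ∀ n, 0 ≤ q n := fun n => by positivity
  have hm0 : ∀ n, 0 ≤ min (q n) (p n) := fun n => le_min (hq0 n) (hp0 n)
  have hms : Summable fun n => min (q n) (p n) :=
    Summable.of_nonneg_of_le hm0 (fun n => min_le_right _ _) hps.summable
  set f : ℕ → ℝ := fun n => Real.exp (-(a + b) / 2) * ((√a * √b) ^ n / n.factorial) with hf
  have hfs : HasSum f (Real.exp (-(a + b) / 2) * Real.exp (√a * √b)) := by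
    have := (NormedSpace.expSeries_div_hasSum_exp (√a * √b)).mul_left (Real.exp (-(a + b) / 2))
    rwa [← Real.exp_eq_exp_ℝ] at this
  have hf2 : ∀ n, f n ^ 2 = min (q n) (p n) * max (q n) (p n) := by
    intro n
    rw [min_mul_max]
    have h1 : Real.exp (-(a + b) / 2) ^ 2 = Real.exp (-b) * Real.exp (-a) := by
      rw [← Real.exp_add, ← Real.exp_nat_mul]
      congr 1
      push_cast
      ring
    have h2 : ((√a * √b) ^ n) ^ 2 = b ^ n * a ^ n := by
      rw [← pow_mul, mul_comm n 2, pow_mul, mul_pow (√a), Real.sq_sqrt ha, Real.sq_sqrt hb,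
        mul_pow, mul_comm]
    simp only [hf, hp, hq]
    rw [mul_pow, div_pow, h1, h2]
    ring
  have hfle : ∀ n, f n ≤ 2 * min (q n) (p n) + (q n + p n) / 8 := by
    intro n
    have h1 : max (q n) (p n) ≤ q n + p n :=
      max_le (by linarith [hp0 n]) (by linarith [hq0 n])
    have h2 : f n ≤ 2 * min (q n) (p n) + max (q n) (p n) / 8 := by
      have := hm0 n
      have : 0 ≤ max (q n) (p n) := (hq0 n).trans (le_max_left _ _)
      refine abs_le_of_sq_le_sq' ?_ (by positivity) |>.2
      rw [hf2]
      nlinarith [sq_nonneg (2 * min (q n) (p n) - max (q n) (p n) / 8)]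
    linarith
  have hle := hasSum_le hfle hfs ((hms.hasSum.mul_left 2).add ((hqs.add hps).div_const 8))
  have hexp : 1 / 2 ≤ Real.exp (-(a + b) / 2) * Real.exp (√a * √b) := by
    rw [← Real.exp_add]
    have h1 := Real.add_one_le_exp (-(a + b) / 2 + √a * √b)
    nlinarith [Real.sq_sqrt ha, Real.sq_sqrt hb]
  have hsum : 1 / 8 ≤ ∑' n, min (q n) (p n) := by linarith
  refine (ENNReal.ofReal_le_ofReal hsum).trans ?_
  rw [ENNReal.ofReal_tsum_of_nonneg hm0 hms]
  refine le_of_eq (tsum_congr fun n => ?_)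
  rw [poissonMeasure_singleton, poissonMeasure_singleton, ENNReal.ofReal_min,
    Real.coe_toNNReal _ ha, Real.coe_toNNReal _ hb]

/-- A measure on triples `(e, x, e')` which is symmetric in `e` and `e'`, under which `(e, x)` is
a uniform bit with an observation from `P e`; the bits differ as often as the overlap allows. -/
noncomputable def bitCoupling (P : Bool → Measure ℕ) : Measure (Bool × ℕ × Bool) :=
  Measure.sum fun t =>
    (if t.1 = t.2.2 then 2⁻¹ * (P t.1 {t.2.1} - min (P true {t.2.1}) (P false {t.2.1}))
      else 2⁻¹ * min (P true {t.2.1}) (P false {t.2.1})) • Measure.dirac t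

section BitCoupling

variable (P : Bool → Measure ℕ)

theorem bitCoupling_singleton (e e' : Bool) (x : ℕ) :
    bitCoupling P {(e, x, e')} =
      if e = e' then 2⁻¹ * (P e {x} - min (P true {x}) (P false {x}))
      else 2⁻¹ * min (P true {x}) (P false {x}) := by
  rw [bitCoupling, Measure.sum_smul_dirac_singleton]

theorem bitCoupling_map_left_singleton (e : Bool) (x : ℕ) :
    (bitCoupling P).map (fun t => (t.1, t.2.1)) {(e, x)} = 2⁻¹ * P e {x} := by
  rw [Measure.map_apply .of_discrete (measurableSet_singleton _)]
  have : (fun t : Bool × ℕ × Bool => (t.1, t.2.1)) ⁻¹' {(e, x)} = {(e, x, e)} ∪ {(e, x, !e)} := by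
    ext ⟨e1, x1, e2⟩
    cases e <;> cases e2 <;> simp
  rw [this, measure_union (by cases e <;> simp) (measurableSet_singleton _),
    bitCoupling_singleton, bitCoupling_singleton, if_pos rfl, if_neg (by cases e <;> simp),
    ← mul_add, tsub_add_cancel_of_le]
  cases e
  · exact min_le_right _ _
  · exact min_le_left _ _

theorem bitCoupling_map_swap :
    (bitCoupling P).map (fun t => (t.2.2, t.2.1, t.1)) = bitCoupling P := by
  refine Measure.ext_of_singleton fun ⟨e, x, e'⟩ => ?_
  rw [Measure.map_apply .of_discrete (measurableSet_singleton _)]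
  have : (fun t : Bool × ℕ × Bool => (t.2.2, t.2.1, t.1)) ⁻¹' {(e, x, e')} = {(e', x, e)} := by
    ext ⟨e1, x1, e2⟩
    simp only [Set.mem_preimage, Set.mem_singleton_iff, Prod.mk.injEq]
    tauto
  rw [this, bitCoupling_singleton, bitCoupling_singleton]
  by_cases h : e = e'
  · subst h; rfl
  · rw [if_neg h, if_neg (Ne.symm h)]

theorem bitCoupling_map_right :
    (bitCoupling P).map (fun t => (t.2.2, t.2.1)) =
      (bitCoupling P).map (fun t => (t.1, t.2.1)) := by
  conv_rhs => rw [← bitCoupling_map_swap, Measure.map_map .of_discrete .of_discrete]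
  rfl

instance [∀ e, IsProbabilityMeasure (P e)] : IsProbabilityMeasure (bitCoupling P) := by
  constructor
  have h1 : bitCoupling P Set.univ = (bitCoupling P).map (fun t => (t.1, t.2.1)) Set.univ := by
    rw [Measure.map_apply .of_discrete .univ, Set.preimage_univ]
  have h2 : ∀ e, ∑' x, P e {x} = 1 := fun e => by
    have := lintegral_countable' (μ := P e) (fun _ => 1)
    simpa using this.symm
  have h3 := lintegral_countable' (μ := (bitCoupling P).map (fun t => (t.1, t.2.1))) (fun _ => 1)
  rw [lintegral_one] at h3
  rw [h1, h3, ENNReal.tsum_prod']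
  simp only [bitCoupling_map_left_singleton, one_mul, ENNReal.tsum_mul_left, h2, mul_one]
  rw [tsum_bool, ENNReal.inv_two_add_inv_two]

theorem bitCoupling_ne :
    bitCoupling P {t | t.1 ≠ t.2.2} = ∑' x, min (P true {x}) (P false {x}) := by
  have := lintegral_countable' (μ := bitCoupling P)
    (Set.indicator {t : Bool × ℕ × Bool | t.1 ≠ t.2.2} 1)
  rw [lintegral_indicator_one .of_discrete] at this
  rw [this, ENNReal.tsum_prod', tsum_bool]
  simp only [ENNReal.tsum_prod', tsum_bool, bitCoupling_singleton]
  simp only [Set.indicator_apply, Set.mem_ofPred_eq, ne_eq, not_true_eq_false, if_false,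
    reduceCtorEq, not_false_eq_true, if_true, Pi.one_apply, one_mul, zero_mul, zero_add, add_zero]
  rw [← ENNReal.tsum_add]
  refine tsum_congr fun x => ?_
  rw [← add_mul, ENNReal.inv_two_add_inv_two, one_mul]

end BitCoupling

/-- Independent copies of `bitCoupling` placed at the entries of a `k × s` array. -/
noncomputable def arrayCoupling (k s : ℕ) (P : Bool → Measure ℕ) :
    Measure (Fin k → Fin s → Bool × ℕ × Bool) :=
  Measure.pi fun _ => Measure.pi fun _ => bitCoupling P

section ArrayCoupling

variable {k s : ℕ} (P : Bool → Measure ℕ) [∀ e, IsProbabilityMeasure (P e)]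

instance : IsProbabilityMeasure (arrayCoupling k s P) := by
  unfold arrayCoupling; infer_instance

theorem arrayCoupling_map {β : Type*} [MeasurableSpace β]
    (f : Fin k → Fin s → Bool × ℕ × Bool → β) :
    (arrayCoupling k s P).map (fun t i j => f i j (t i j)) =
      Measure.pi fun i => Measure.pi fun j => (bitCoupling P).map (f i j) := by
  have hf : ∀ i j, Measurable (f i j) := fun i j => .of_discrete
  have : ∀ i j, IsProbabilityMeasure ((bitCoupling P).map (f i j)) := fun i j =>
    Measure.isProbabilityMeasure_map (hf i j).aemeasurable
  have h1 : ∀ i, (Measure.pi fun _ : Fin s => bitCoupling P).map (fun t j => f i j (t j)) =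
      Measure.pi fun j => (bitCoupling P).map (f i j) := fun i =>
    Measure.pi_map_pi fun j => (hf i j).aemeasurable
  have h2 : ∀ i, IsProbabilityMeasure
      ((Measure.pi fun _ : Fin s => bitCoupling P).map fun t j => f i j (t j)) := fun i => by
    rw [h1]; infer_instance
  simp only [← h1]
  exact Measure.pi_map_pi fun i => (measurable_pi_lambda _ fun j =>
    (hf i j).comp (measurable_pi_apply j)).aemeasurable

theorem arrayCoupling_map_eval (i : Fin k) (j : Fin s) :
    (arrayCoupling k s P).map (fun t => t i j) = bitCoupling P :=
  ((measurePreserving_eval (fun _ : Fin s => bitCoupling P) j).comp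
    (measurePreserving_eval (fun _ : Fin k => Measure.pi fun _ : Fin s => bitCoupling P) i)).map_eq

/-- The risk averaged over uniform bits is at most the worst-case risk. -/
theorem exists_lintegral_arrayCoupling_le
    (g : (Fin k → Fin s → Bool) → (Fin k → Fin s → ℕ) → ℝ≥0∞) :
    ∃ ε : Fin k → Fin s → Bool,
      ∫⁻ t, g (fun i j => (t i j).1) (fun i j => (t i j).2.1) ∂(arrayCoupling k s P) ≤
        ∫⁻ x, g ε x ∂(Measure.pi fun i => Measure.pi fun j => P (ε i j)) := by
  obtain ⟨ε, hε⟩ := Finite.exists_max fun ε : Fin k → Fin s → Bool =>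
    ∫⁻ x, g ε x ∂(Measure.pi fun i => Measure.pi fun j => P (ε i j))
  refine ⟨ε, ?_⟩
  set L := ∫⁻ x, g ε x ∂(Measure.pi fun i => Measure.pi fun j => P (ε i j))
  have : IsProbabilityMeasure ((bitCoupling P).map fun t => (t.1, t.2.1)) :=
    Measure.isProbabilityMeasure_map (Measurable.of_discrete).aemeasurable
  let G : (Fin k → Fin s → Bool × ℕ) → ℝ≥0∞ := fun y => g (fun i j => (y i j).1) fun i j => (y i j).2
  let E : (Fin k → Fin s → Bool) × (Fin k → Fin s → ℕ) ≃ (Fin k → Fin s → Bool × ℕ) :=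
    { toFun := fun z i j => (z.1 i j, z.2 i j)
      invFun := fun y => (fun i j => (y i j).1, fun i j => (y i j).2)
      left_inv := fun _ => rfl
      right_inv := fun _ => rfl }
  have h1 : ∫⁻ t, g (fun i j => (t i j).1) (fun i j => (t i j).2.1) ∂(arrayCoupling k s P) =
      ∫⁻ y, G y ∂((arrayCoupling k s P).map fun t i j => ((t i j).1, (t i j).2.1)) := by
    rw [lintegral_map .of_discrete .of_discrete]
  rw [h1, arrayCoupling_map P fun _ _ t => (t.1, t.2.1), lintegral_countable', ← E.tsum_eq,
    ENNReal.tsum_prod']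
  have h2 : ∀ (e : Fin k → Fin s → Bool), ∑' x : Fin k → Fin s → ℕ, G (E (e, x)) *
      (Measure.pi fun _ => Measure.pi fun _ => (bitCoupling P).map fun t => (t.1, t.2.1))
        {E (e, x)} = (2⁻¹ ^ s) ^ k *
          ∫⁻ x, g e x ∂(Measure.pi fun i => Measure.pi fun j => P (e i j)) := by
    intro e
    rw [lintegral_countable', ← ENNReal.tsum_mul_left]
    refine tsum_congr fun x => ?_
    simp only [Measure.pi_singleton]
    have h3 : ∀ i j, (bitCoupling P).map (fun t => (t.1, t.2.1)) {E (e, x) i j} =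
        2⁻¹ * P (e i j) {x i j} := fun i j => bitCoupling_map_left_singleton P _ _
    simp only [h3, Finset.prod_mul_distrib, Finset.prod_const, Finset.card_univ, Fintype.card_fin]
    change g e x * _ = _
    ring
  simp only [h2]
  rw [ENNReal.tsum_mul_left]
  have h3 : ∑' e : Fin k → Fin s → Bool,
      ∫⁻ x, g e x ∂(Measure.pi fun i => Measure.pi fun j => P (e i j)) ≤ (2 ^ s) ^ k * L := by
    rw [tsum_fintype]
    refine (Finset.sum_le_card_nsmul _ _ L fun e _ => hε e).trans (le_of_eq ?_)
    simp
  refine (mul_le_mul_right h3 _).trans (le_of_eq ?_)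
  rw [← mul_assoc, ← mul_pow, ← mul_pow, ENNReal.inv_mul_cancel (by simp) (by simp)]
  simp

/-- The difference of the two rate matrices encoded by a coupled array, for rate gap `h`. -/
def rateGap (h : ℝ) (t : Fin k → Fin s → Bool × ℕ × Bool) : Matrix (Fin k) (Fin s) ℝ :=
  Matrix.of fun i j => h * ((t i j).1.toNat - (t i j).2.2.toNat)

theorem abs_rateGap_le {h : ℝ} (hh : 0 ≤ h) (t : Fin k → Fin s → Bool × ℕ × Bool)
    (i : Fin k) (j : Fin s) : |rateGap h t i j| ≤ h := by
  simp only [rateGap, Matrix.of_apply]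
  cases (t i j).1 <;> cases (t i j).2.2 <;> simp [abs_of_nonneg hh, hh]

theorem integrable_comp_rateGap (h : ℝ) (φ : Matrix (Fin k) (Fin s) ℝ → ℝ) :
    Integrable (fun t => φ (rateGap h t)) (arrayCoupling k s P) := by
  obtain ⟨e, he⟩ := Finite.exists_max fun e : Fin k → Fin s → Bool × Bool =>
    |φ (Matrix.of fun i j => h * ((e i j).1.toNat - (e i j).2.toNat))|
  exact .of_bound (Measurable.of_discrete).aestronglyMeasurable _
    (.of_forall fun t => he fun i j => ((t i j).1, (t i j).2.2))

theorem integral_rateGap_sq (h : ℝ) (i : Fin k) (j : Fin s) :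
    ∫ t, rateGap h t i j * rateGap h t i j ∂(arrayCoupling k s P) =
      h ^ 2 * (bitCoupling P).real {t | t.1 ≠ t.2.2} := by
  have h1 : ∀ t : Fin k → Fin s → Bool × ℕ × Bool, rateGap h t i j * rateGap h t i j =
      Set.indicator {t : Bool × ℕ × Bool | t.1 ≠ t.2.2} (fun _ => h ^ 2) (t i j) := by
    intro t
    simp only [rateGap, Matrix.of_apply, Set.indicator_apply, Set.mem_ofPred_eq]
    obtain ⟨e, x, e'⟩ := t i j
    cases e <;> cases e' <;> (simp; try ring)
  simp only [h1]
  rw [← integral_map (φ := fun t : Fin k → Fin s → Bool × ℕ × Bool => t i j)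
    (f := Set.indicator {t : Bool × ℕ × Bool | t.1 ≠ t.2.2} (fun _ => h ^ 2))
    (Measurable.of_discrete).aemeasurable (Measurable.of_discrete).aestronglyMeasurable,
    arrayCoupling_map_eval, integral_indicator_const _ .of_discrete, smul_eq_mul, mul_comm]

theorem integral_rateGap_rectangle (h : ℝ) {i i' : Fin k} {j j' : Fin s} (hi : i ≠ i')
    (hj : j ≠ j') :
    ∫ t, rateGap h t i j * rateGap h t i' j * (rateGap h t i' j' * rateGap h t i j')
      ∂(arrayCoupling k s P) = 0 := by
  let F : Fin k → Fin s → Bool × ℕ × Bool → Bool × ℕ × Bool := fun a b t =>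
    if a = i ∧ b = j then (t.2.2, t.2.1, t.1) else t
  have hF : (arrayCoupling k s P).map (fun t a b => F a b (t a b)) = arrayCoupling k s P := by
    rw [arrayCoupling_map]
    congr 1; funext a; congr 1; funext b
    by_cases hab : a = i ∧ b = j
    · simp only [F, if_pos hab, bitCoupling_map_swap]
    · simp only [F, if_neg hab]
      exact Measure.map_id
  have h1 : ∀ t a b, rateGap h (fun a b => F a b (t a b)) a b =
      if a = i ∧ b = j then - rateGap h t a b else rateGap h t a b := by
    intro t a b
    by_cases hab : a = i ∧ b = j
    · simp only [rateGap, Matrix.of_apply, F, if_pos hab]; ring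
    · simp only [rateGap, Matrix.of_apply, F, if_neg hab]
  have h2 := integral_map (μ := arrayCoupling k s P) (φ := fun t a b => F a b (t a b))
    (f := fun t => rateGap h t i j * rateGap h t i' j * (rateGap h t i' j' * rateGap h t i j'))
    (Measurable.of_discrete).aemeasurable (Measurable.of_discrete).aestronglyMeasurable
  rw [hF] at h2
  simp only [h1, hi.symm, hj.symm, and_self, and_false, false_and, if_true, if_false, neg_mul,
    integral_neg] at h2
  linarith

theorem integral_trace_rateGap (h : ℝ) :
    ∫ t, (rateGap h t * (rateGap h t)ᵀ).trace ∂(arrayCoupling k s P) =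
      k * s * (h ^ 2 * (bitCoupling P).real {t | t.1 ≠ t.2.2}) := by
  simp only [Matrix.trace, Matrix.diag_apply, Matrix.mul_apply, Matrix.transpose_apply]
  rw [integral_finsetSum _ fun i _ => integrable_comp_rateGap P h fun M => ∑ j, M i j * M i j]
  have h1 : ∀ i, ∫ t, ∑ j, rateGap h t i j * rateGap h t i j ∂(arrayCoupling k s P) =
      s * (h ^ 2 * (bitCoupling P).real {t | t.1 ≠ t.2.2}) := by
    intro i
    rw [integral_finsetSum _ fun j _ => integrable_comp_rateGap P h fun M => M i j * M i j]
    simp only [integral_rateGap_sq, Finset.sum_const, Finset.card_univ, Fintype.card_fin,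
      nsmul_eq_mul]
  simp only [h1, Finset.sum_const, Finset.card_univ, Fintype.card_fin, nsmul_eq_mul, mul_assoc]

theorem integral_trace_sq_rateGap_le {h : ℝ} (hh : 0 ≤ h) :
    ∫ t, (rateGap h t * (rateGap h t)ᵀ * (rateGap h t * (rateGap h t)ᵀ)).trace
      ∂(arrayCoupling k s P) ≤ h ^ 4 * (k * s * s + k * k * s) := by
  have hexp : ∀ M : Matrix (Fin k) (Fin s) ℝ, (M * Mᵀ * (M * Mᵀ)).trace =
      ∑ i, ∑ i', ∑ j, ∑ j', M i j * M i' j * (M i' j' * M i j') := by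
    intro M
    simp only [Matrix.trace, Matrix.diag_apply, Matrix.mul_apply, Matrix.transpose_apply,
      Finset.sum_mul_sum]
  simp only [hexp]
  have hterm : ∀ (i i' : Fin k) (j j' : Fin s),
      ∫ t, rateGap h t i j * rateGap h t i' j * (rateGap h t i' j' * rateGap h t i j')
        ∂(arrayCoupling k s P) ≤
        h ^ 4 * ((if i = i' then 1 else 0) + if j = j' then 1 else 0) := by
    intro i i' j j'
    by_cases hij : i ≠ i' ∧ j ≠ j'
    · rw [integral_rateGap_rectangle P h hij.1 hij.2]
      simp [hij.1, hij.2]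
    · have hle : ∫ t, rateGap h t i j * rateGap h t i' j * (rateGap h t i' j' * rateGap h t i j')
          ∂(arrayCoupling k s P) ≤ ∫ _, h ^ 4 ∂(arrayCoupling k s P) := by
        refine integral_mono (integrable_comp_rateGap P h
          fun M => M i j * M i' j * (M i' j' * M i j')) (integrable_const _) fun t => ?_
        refine (le_abs_self _).trans ?_
        simp only [abs_mul]
        calc _ ≤ h * h * (h * h) := by gcongr <;> exact abs_rateGap_le hh t _ _
          _ = h ^ 4 := by ring
      rw [integral_const, probReal_univ, one_smul] at hle
      refine hle.trans (le_mul_of_one_le_right (by positivity) ?_)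
      by_cases hi : i = i'
      · rw [if_pos hi]; split_ifs <;> norm_num
      · rw [if_pos (not_not.mp fun hj => hij ⟨hi, hj⟩)]; simp [hi]
  rw [integral_finsetSum _ fun i _ => integrable_comp_rateGap P h
    fun M => ∑ i', ∑ j, ∑ j', M i j * M i' j * (M i' j' * M i j')]
  have hsum : ∑ i : Fin k, ∑ i' : Fin k, ∑ j : Fin s, ∑ j' : Fin s,
      h ^ 4 * ((if i = i' then (1 : ℝ) else 0) + if j = j' then 1 else 0) =
        h ^ 4 * (k * s * s + k * k * s) := by
    simp only [← Finset.mul_sum, Finset.sum_add_distrib, Finset.sum_const, Finset.card_univ,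
      Fintype.card_fin, nsmul_eq_mul, Finset.sum_ite_eq, Finset.mem_univ, if_true, mul_one]
    ring
  rw [← hsum]
  refine Finset.sum_le_sum fun i _ => ?_
  rw [integral_finsetSum _ fun i' _ => integrable_comp_rateGap P h
    fun M => ∑ j, ∑ j', M i j * M i' j * (M i' j' * M i j')]
  refine Finset.sum_le_sum fun i' _ => ?_
  rw [integral_finsetSum _ fun j _ => integrable_comp_rateGap P h
    fun M => ∑ j', M i j * M i' j * (M i' j' * M i j')]
  refine Finset.sum_le_sum fun j _ => ?_
  rw [integral_finsetSum _ fun j' _ => integrable_comp_rateGap P h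
    fun M => M i j * M i' j * (M i' j' * M i j')]
  exact Finset.sum_le_sum fun j' _ => hterm i i' j j'

end ArrayCoupling

/-- The expected norm of the rate gap, bounded below through the trace functional. -/
theorem mul_norm_le_integral_norm_rateGap {k s : ℕ} (hk : 1 ≤ k) (hs : 1 ≤ s)
    (P : Bool → Measure ℕ) [∀ e, IsProbabilityMeasure (P e)]
    {nrm : Matrix (Fin k) (Fin s) ℝ → ℝ} (hn : IsMatrixNorm nrm) (hu : IsUnitarilyInvariant nrm)
    {h : ℝ} (hh : 0 < h) (hP : 1 / 8 ≤ (bitCoupling P).real {t | t.1 ≠ t.2.2}) :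
    3 / 128 * (√(max k s : ℝ) * h * nrm (Imat k s (min k s))) ≤
      ∫ t, nrm (rateGap h t) ∂(arrayCoupling k s P) := by
  set N := nrm (Imat k s (min k s))
  set m : ℝ := max (k : ℝ) s
  set r : ℝ := min (k : ℝ) s
  have hk' : (1 : ℝ) ≤ k := by exact_mod_cast hk
  have hs' : (1 : ℝ) ≤ s := by exact_mod_cast hs
  have hr0 : 0 < r := lt_min (by linarith) (by linarith)
  have hm0 : 0 < m := lt_max_of_lt_left (by linarith)
  have hrm : r * m = k * s := min_mul_max _ _
  have hN0 : 0 ≤ N := hn.nonneg_s17 _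
  have hq0 : 0 < √m := Real.sqrt_pos.mpr hm0
  have hq2 : √m ^ 2 = m := Real.sq_sqrt hm0.le
  set a := 4 * (√m * h) with ha
  have ha0 : 0 < a := by positivity
  have hint := integral_mono
    (integrable_comp_rateGap P h fun M => ((M * Mᵀ).trace / a -
      (M * Mᵀ * (M * Mᵀ)).trace / (4 * a ^ 3)) * N)
    (integrable_comp_rateGap P h fun M => r * nrm M)
    fun t => norm_lower_bound hk hs hn hu (rateGap h t) ha0
  rw [integral_mul_const, integral_const_mul, integral_sub
    (integrable_comp_rateGap P h fun M => (M * Mᵀ).trace / a)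
    (integrable_comp_rateGap P h fun M => (M * Mᵀ * (M * Mᵀ)).trace / (4 * a ^ 3)),
    integral_div, integral_div, integral_trace_rateGap] at hint
  have h4 := integral_trace_sq_rateGap_le (k := k) (s := s) P hh.le
  have hks : (k * s * s + k * k * s : ℝ) ≤ 2 * (r * m * m) := by
    have h1 : (k : ℝ) ≤ m := le_max_left _ _
    have h2 : (s : ℝ) ≤ m := le_max_right _ _
    have : 0 ≤ (k * s : ℝ) := by positivity
    rw [hrm]
    nlinarith
  have h5 : (∫ t, (rateGap h t * (rateGap h t)ᵀ * (rateGap h t * (rateGap h t)ᵀ)).trace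
      ∂(arrayCoupling k s P)) / (4 * a ^ 3) ≤ h ^ 4 * (2 * (r * m * m)) / (4 * a ^ 3) := by
    gcongr
    exact h4.trans (by gcongr)
  have h6 : r * m * (h ^ 2 * (1 / 8)) / a ≤
      k * s * (h ^ 2 * (bitCoupling P).real {t | t.1 ≠ t.2.2}) / a := by
    rw [hrm]
    gcongr
  have h7 : r * m * (h ^ 2 * (1 / 8)) / a - h ^ 4 * (2 * (r * m * m)) / (4 * a ^ 3) =
      r * (3 / 128 * (√m * h)) := by
    obtain ⟨q, hq⟩ : ∃ q, q = √m := ⟨_, rfl⟩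
    rw [← hq] at hq0 hq2
    rw [ha, ← hq, ← hq2]
    field_simp
    ring
  have h8 : r * (3 / 128 * (√m * h)) * N ≤ r * ∫ t, nrm (rateGap h t) ∂(arrayCoupling k s P) :=
    (mul_le_mul_of_nonneg_right (by linarith) hN0).trans hint
  rw [mul_assoc] at h8
  have := le_of_mul_le_mul_left h8 hr0
  linarith

theorem ofReal_integral_le_lintegral_ofReal {α : Type*} [MeasurableSpace α] {μ : Measure α}
    {f : α → ℝ} (hf : Integrable f μ) :
    ENNReal.ofReal (∫ x, f x ∂μ) ≤ ∫⁻ x, ENNReal.ofReal (f x) ∂μ := by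
  have h1 : ∫ x, f x ∂μ ≤ ∫ x, max (f x) 0 ∂μ :=
    integral_mono hf hf.pos_part fun x => le_max_left _ _
  refine (ENNReal.ofReal_le_ofReal h1).trans ?_
  rw [ofReal_integral_eq_lintegral_ofReal hf.pos_part (.of_forall fun x => le_max_right _ _)]
  exact lintegral_mono fun x => by simp [ENNReal.ofReal_max]

theorem exists_risk_lower_bound {k s : ℕ} (hk : 1 ≤ k) (hs : 1 ≤ s)
    {nrm : Matrix (Fin k) (Fin s) ℝ → ℝ} (hn : IsMatrixNorm nrm) (hu : IsUnitarilyInvariant nrm)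
    {a h : ℝ} (ha : 0 ≤ a) (hh : 0 < h) (hah : (√(a + h) - √a) ^ 2 ≤ 1)
    (est : (Fin k → Fin s → ℕ) → Matrix (Fin k) (Fin s) ℝ) :
    ∃ ε : Fin k → Fin s → Bool,
      ENNReal.ofReal ((3 / 128 * (√(max k s : ℝ) * h * nrm (Imat k s (min k s)))) ^ 2 / 4) ≤
        ∫⁻ x, ENNReal.ofReal (nrm (est x - Matrix.of fun i j => a + h * (ε i j).toNat) ^ 2)
          ∂(poissonMatrixMeasure k s (Matrix.of fun i j => a + h * (ε i j).toNat)) := by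
  let P : Bool → Measure ℕ := fun e => poissonMeasure (a + h * e.toNat).toNNReal
  have : ∀ e, IsProbabilityMeasure (P e) := fun e => by
    simp only [P]; infer_instance
  have hP : 1 / 8 ≤ (bitCoupling P).real {t | t.1 ≠ t.2.2} := by
    rw [measureReal_def, ← ENNReal.ofReal_le_iff_le_toReal (measure_ne_top _ _), bitCoupling_ne]
    simpa [P] using one_eighth_le_tsum_min_poisson ha (by linarith) hah
  set B := 3 / 128 * (√(max k s : ℝ) * h * nrm (Imat k s (min k s)))
  have hB0 : 0 ≤ B := by have := hn.nonneg_s17 (Imat k s (min k s)); positivity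
  have hB : B ≤ ∫ t, nrm (rateGap h t) ∂(arrayCoupling k s P) :=
    mul_norm_le_integral_norm_rateGap hk hs P hn hu hh hP
  let f : (Fin k → Fin s → Bool) → (Fin k → Fin s → ℕ) → ℝ≥0∞ := fun ε x =>
    ENNReal.ofReal (nrm (est x - Matrix.of fun i j => a + h * (ε i j).toNat) ^ 2)
  obtain ⟨ε, hε⟩ := exists_lintegral_arrayCoupling_le P f
  refine ⟨ε, le_trans ?_ hε⟩
  set A := ∫⁻ t, f (fun i j => (t i j).1) (fun i j => (t i j).2.1) ∂(arrayCoupling k s P) with hA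
  have hA' : ∫⁻ t, f (fun i j => (t i j).2.2) (fun i j => (t i j).2.1) ∂(arrayCoupling k s P)
      = A := by
    have h1 := arrayCoupling_map (k := k) (s := s) P fun _ _ t => (t.2.2, t.2.1)
    rw [bitCoupling_map_right, ← arrayCoupling_map P fun _ _ t => (t.1, t.2.1)] at h1
    have h2 := congrArg (fun μ => ∫⁻ y : Fin k → Fin s → Bool × ℕ,
      f (fun i j => (y i j).1) (fun i j => (y i j).2) ∂μ) h1
    simpa only [lintegral_map (Measurable.of_discrete) (Measurable.of_discrete)] using h2
  have h2A : ENNReal.ofReal (B ^ 2 / 2) ≤ A + A := by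
    nth_rewrite 2 [← hA']
    rw [hA, ← lintegral_add_left .of_discrete]
    have hint := integrable_comp_rateGap (k := k) (s := s) P h fun M => B * nrm M - B ^ 2 / 2
    have h1 : B ^ 2 / 2 ≤ ∫ t, (B * nrm (rateGap h t) - B ^ 2 / 2) ∂(arrayCoupling k s P) := by
      rw [integral_sub (integrable_comp_rateGap P h fun M => B * nrm M) (integrable_const _),
        integral_const_mul, integral_const, probReal_univ, one_smul]
      nlinarith
    refine (ENNReal.ofReal_le_ofReal h1).trans
      ((ofReal_integral_le_lintegral_ofReal hint).trans (lintegral_mono fun t => ?_))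
    simp only [f]
    rw [← ENNReal.ofReal_add (sq_nonneg _) (sq_nonneg _)]
    refine ENNReal.ofReal_le_ofReal ?_
    set X := est fun i j => (t i j).2.1
    set L : Matrix (Fin k) (Fin s) ℝ := Matrix.of fun i j => a + h * (t i j).1.toNat with hL
    set L' : Matrix (Fin k) (Fin s) ℝ := Matrix.of fun i j => a + h * (t i j).2.2.toNat with hL'
    have hgap : rateGap h t = -(X - L) + (X - L') := by
      ext i j
      simp only [rateGap, hL, hL', Matrix.of_apply, Matrix.add_apply, Matrix.neg_apply,
        Matrix.sub_apply]
      ring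
    have htri : nrm (rateGap h t) ≤ nrm (X - L) + nrm (X - L') := by
      rw [hgap]
      exact (hn.1 _ _).trans (by rw [hn.map_neg])
    have := mul_le_mul_of_nonneg_left htri hB0
    nlinarith [sq_nonneg (nrm (X - L) - B / 2), sq_nonneg (nrm (X - L') - B / 2)]
  have hsplit : ENNReal.ofReal (B ^ 2 / 2) = 2 * ENNReal.ofReal (B ^ 2 / 4) := by
    rw [← ENNReal.ofReal_ofNat 2, ← ENNReal.ofReal_mul (by norm_num)]
    congr 1; ring
  rw [hsplit, ← two_mul] at h2A
  exact (ENNReal.mul_le_mul_iff_right (by simp) (by simp)).mp h2A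

/-- Minimax lower bound for Poisson rate matrix estimation under
unitarily invariant norms: there is an absolute constant `c > 0` such that for all
`k, s ≥ 1`, `λ > 0`, and every unitarily invariant norm `‖·‖` on `ℝ^{k×s}`, any
measurable estimator has worst-case risk over `Γ(k,s,λ)` at least
`c · max(k,s) · ‖I_r‖² · min(λ, λ²)`, `r = min(k,s)`. -/
theorem poisson_rate_matrix_minimax_lower_bound :
    ∃ c : ℝ, 0 < c ∧
      ∀ (k s : ℕ), 1 ≤ k → 1 ≤ s → ∀ lam : ℝ, 0 < lam →
        ∀ nrm : Matrix (Fin k) (Fin s) ℝ → ℝ,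
          IsMatrixNorm nrm → IsUnitarilyInvariant nrm →
          ∀ est : (Fin k → Fin s → ℕ) → Matrix (Fin k) (Fin s) ℝ, Measurable est →
            ∃ Λ : Matrix (Fin k) (Fin s) ℝ,
              (∀ i j, 0 ≤ Λ i j ∧ Λ i j ≤ lam) ∧
              ENNReal.ofReal (c * (max k s : ℝ) * nrm (Imat k s (min k s)) ^ 2 *
                  min lam (lam ^ 2))
                ≤ ∫⁻ x, ENNReal.ofReal (nrm (est x - Λ) ^ 2)
                    ∂(poissonMatrixMeasure k s Λ) := by
  refine ⟨(3 / 128) ^ 2 / 4, by norm_num, ?_⟩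
  intro k s hk hs lam hlam nrm hn hu est _
  set h := √(min lam (lam ^ 2)) with hh
  have hmin : 0 < min lam (lam ^ 2) := lt_min hlam (by positivity)
  have hh0 : 0 < h := Real.sqrt_pos.mpr hmin
  have hh2 : h ^ 2 = min lam (lam ^ 2) := Real.sq_sqrt hmin.le
  have hhl : h ≤ lam :=
    abs_le_of_sq_le_sq' (hh2.trans_le (min_le_right _ _)) hlam.le |>.2
  have hgap : (√(lam - h + h) - √(lam - h)) ^ 2 ≤ 1 := by
    rw [sub_add_cancel]
    have h1 := Real.sq_sqrt hlam.le
    have h2 := Real.sq_sqrt (sub_nonneg.mpr hhl)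
    have h3 : √(lam - h) ≤ √lam := Real.sqrt_le_sqrt (by linarith)
    have h4 := Real.sqrt_nonneg (lam - h)
    have h5 : (√lam - √(lam - h)) * √lam ≤ h := by nlinarith
    have h6 : ((√lam - √(lam - h)) * √lam) ^ 2 ≤ h ^ 2 :=
      pow_le_pow_left₀ (mul_nonneg (by linarith) (Real.sqrt_nonneg _)) h5 2
    rw [mul_pow, h1, hh2] at h6
    have h7 : (√lam - √(lam - h)) ^ 2 * lam ≤ 1 * lam := by
      rw [one_mul]; exact h6.trans (min_le_left _ _)
    exact le_of_mul_le_mul_right h7 hlam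
  obtain ⟨ε, hε⟩ := exists_risk_lower_bound hk hs hn hu (sub_nonneg.mpr hhl) hh0 hgap est
  refine ⟨_, fun i j => ?_, le_trans (le_of_eq ?_) hε⟩
  · simp only [Matrix.of_apply]
    cases ε i j
    · simpa using ⟨hhl, hh0.le⟩
    · simpa using hlam.le
  · congr 1
    have hm : (√(max k s : ℝ)) ^ 2 = max (k : ℝ) s := Real.sq_sqrt (by positivity)
    rw [← hh2, mul_pow, mul_pow, mul_pow, hm]
    ring
end
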